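/- arXiv:2304.10708 — 4 statements merged into one kernel-verified Lean document; each statement's English description precedes it below -/
import Mathlib

section
/- Let λ = (λ_1 ≥ ⋯ ≥ λ_l > 0) be a partition and let q ≥ 2 be an integer. Then the integer ∏_{s=1}^{λ_1} ψ_{λ'_s − λ'_{s+1}}(q) · ∏_{1 ≤ i < j ≤ l} (q^{λ(i) − λ(j)} − 1) divides the integer ∏_{r=1}^{l} ψ_{λ(r)+l}(q); equivalently, Φ(λ, q) is an integer. -/
/-- `ψ_m(q) = ∏_{i=1}^m (q^i - 1)`, so `ψ_0(q) = 1`. -/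
def psi {R : Type*} [CommRing R] (q : R) (m : ℕ) : R :=
  ∏ i ∈ Finset.Icc 1 m, (q ^ i - 1)

/-- The conjugate partition: for the partition `λ_1 ≥ ⋯ ≥ λ_l > 0` given by `lam` on
`{1, …, l}`, `conjPart lam l s = λ'_s` is the number of indices `i ∈ {1, …, l}` with
`λ_i ≥ s` (and `λ'_s = 0` for `s > λ_1`). -/
def conjPart (lam : ℕ → ℕ) (l : ℕ) (s : ℕ) : ℕ :=
  ((Finset.Icc 1 l).filter fun i => s ≤ lam i).card

/-- `Φ(λ, q)`. Here `lam r + l - r = λ(r) + l(λ)` with `λ(r) = λ_r - r`, the exponents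
`λ(i) - λ(j) = lam i + j - (lam j + i)` for `i < j`, and all natural subtractions agree
with the intended integer values. -/
noncomputable def PhiPart (lam : ℕ → ℕ) (l : ℕ) (q : ℚ) : ℚ :=
  (∏ r ∈ Finset.Icc 1 l, psi q (lam r + l - r)) /
    ((∏ s ∈ Finset.Icc 1 (lam 1), psi q (conjPart lam l s - conjPart lam l (s + 1))) *
      ∏ ij ∈ (Finset.Icc 1 l ×ˢ Finset.Icc 1 l).filter fun ij => ij.1 < ij.2,
        (q ^ (lam ij.1 + ij.2 - (lam ij.2 + ij.1)) - 1))

/-- Counting, for each element of a finite set of naturals, the elements that are not below it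
enumerates `1, …, #S`. -/
theorem prod_card_filter_le {M : Type*} [CommMonoid M] (f : ℕ → M) (S : Finset ℕ) :
    ∏ r ∈ S, f (S.filter fun j => r ≤ j).card = ∏ i ∈ Finset.Icc 1 S.card, f i := by
  induction S using Finset.induction_on_min with
  | empty => simp
  | insert a S ha ih =>
    have hnot : a ∉ S := fun h => lt_irrefl _ (ha a h)
    rw [Finset.prod_insert hnot, Finset.card_insert_of_notMem hnot,
      Finset.prod_Icc_succ_top (by omega), mul_comm, ← ih]
    congr 1
    · refine Finset.prod_congr rfl fun r hr => ?_
      rw [Finset.filter_insert, if_neg (not_le.mpr (ha r hr))]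
    · rw [Finset.filter_true_of_mem, Finset.card_insert_of_notMem hnot]
      intro j hj
      rcases Finset.mem_insert.mp hj with rfl | hj
      · exact le_rfl
      · exact (ha j hj).le

/-- `λ'_s - λ'_{s+1}` is the multiplicity of the part `s`. -/
theorem conjPart_sub_conjPart_succ (lam : ℕ → ℕ) (l s : ℕ) :
    conjPart lam l s - conjPart lam l (s + 1) =
      ((Finset.Icc 1 l).filter fun i => lam i = s).card := by
  have h : conjPart lam l s =
      ((Finset.Icc 1 l).filter fun i => lam i = s).card + conjPart lam l (s + 1) := by
    unfold conjPart
    rw [← Finset.card_union_of_disjoint]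
    · congr 1
      ext i
      simp only [Finset.mem_filter, Finset.mem_union, ← and_or_left]
      exact and_congr_right fun _ => by omega
    · rw [Finset.disjoint_filter]
      intro i _ _
      omega
  omega

/-- The hook length of the last box in row `r`. -/
def lastHook (lam : ℕ → ℕ) (l r : ℕ) : ℕ :=
  (((Finset.Icc 1 l).filter fun i => lam i = lam r).filter fun j => r ≤ j).card

theorem prod_psi_conjPart {R : Type*} [CommRing R] (l : ℕ) (lam : ℕ → ℕ)
    (hpos : ∀ i, 1 ≤ i → i ≤ l → 0 < lam i)
    (hanti : ∀ i j, 1 ≤ i → i ≤ j → j ≤ l → lam j ≤ lam i) (q : R) :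
    ∏ s ∈ Finset.Icc 1 (lam 1), psi q (conjPart lam l s - conjPart lam l (s + 1)) =
      ∏ r ∈ Finset.Icc 1 l, (q ^ lastHook lam l r - 1) := by
  have hmaps : ∀ i ∈ Finset.Icc 1 l, lam i ∈ Finset.Icc 1 (lam 1) := by
    intro i hi
    rw [Finset.mem_Icc] at hi ⊢
    exact ⟨hpos i hi.1 hi.2, hanti 1 i le_rfl hi.1 hi.2⟩
  rw [← Finset.prod_fiberwise_of_maps_to hmaps]
  refine Finset.prod_congr rfl fun s _ => ?_
  rw [conjPart_sub_conjPart_succ, psi, ← prod_card_filter_le fun i => q ^ i - 1]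
  refine Finset.prod_congr rfl fun r hr => ?_
  rw [lastHook, (Finset.mem_filter.mp hr).2]

theorem lastHook_mem_Icc {l r : ℕ} {lam : ℕ → ℕ} (hr : 1 ≤ r) (hrl : r ≤ l) :
    lastHook lam l r ∈ Finset.Icc 1 (l + 1 - r) := by
  rw [Finset.mem_Icc, lastHook]
  constructor
  · exact Finset.card_pos.mpr ⟨r, by simp [hr, hrl]⟩
  · rw [← Nat.card_Icc]
    refine Finset.card_le_card fun j => ?_
    simp only [Finset.mem_filter, Finset.mem_Icc]
    omega

theorem lastHook_ne {l r j : ℕ} {lam : ℕ → ℕ}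
    (hanti : ∀ i j, 1 ≤ i → i ≤ j → j ≤ l → lam j ≤ lam i)
    (hr : 1 ≤ r) (hrj : r < j) (hjl : j ≤ l) :
    lastHook lam l r ≠ lam r + j - (lam j + r) := by
  have hj := hanti r j hr hrj.le hjl
  rcases hj.eq_or_lt with heq | hlt
  · have : j + 1 - r ≤ lastHook lam l r := by
      rw [← Nat.card_Icc]
      refine Finset.card_le_card fun i => ?_
      simp only [Finset.mem_filter, Finset.mem_Icc]
      intro hi
      have h1 := hanti r i hr hi.1 (by omega)
      have h2 := hanti i j (by omega) hi.2 hjl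
      omega
    omega
  · have : lastHook lam l r ≤ j - r := by
      rw [← Nat.card_Ico]
      refine Finset.card_le_card fun i => ?_
      simp only [Finset.mem_filter, Finset.mem_Icc, Finset.mem_Ico]
      rintro ⟨⟨⟨h1, h2⟩, h3⟩, h4⟩
      refine ⟨h4, ?_⟩
      by_contra! h
      have := hanti j i (by omega) h h2
      omega
    omega

/-- The factors belonging to row `r` have distinct exponents in `{1, …, λ(r) + l}`. -/
theorem row_dvd_psi {R : Type*} [CommRing R] {l r : ℕ} {lam : ℕ → ℕ}
    (hpos : ∀ i, 1 ≤ i → i ≤ l → 0 < lam i)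
    (hanti : ∀ i j, 1 ≤ i → i ≤ j → j ≤ l → lam j ≤ lam i) (q : R)
    (hr : 1 ≤ r) (hrl : r ≤ l) :
    (q ^ lastHook lam l r - 1) *
        ∏ j ∈ (Finset.Icc 1 l).filter (fun j => r < j), (q ^ (lam r + j - (lam j + r)) - 1) ∣
      psi q (lam r + l - r) := by
  have hinj : Set.InjOn (fun j => lam r + j - (lam j + r))
      ((Finset.Icc 1 l).filter fun j => r < j) := by
    intro i hi j hj hij
    simp only [Finset.coe_filter, Finset.mem_Icc, Set.mem_ofPred_eq] at hi hj hij
    have hi' := hanti r i hr hi.2.le hi.1.2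
    have hj' := hanti r j hr hj.2.le hj.1.2
    rcases le_total i j with h | h
    · have := hanti i j hi.1.1 h hj.1.2
      omega
    · have := hanti j i hj.1.1 h hi.1.2
      omega
  rw [← Finset.prod_image (f := fun e => q ^ e - 1) hinj,
    ← Finset.prod_insert (f := fun e => q ^ e - 1)]
  · refine Finset.prod_dvd_prod_of_subset _ _ _ fun e he => ?_
    have hrpos := hpos r hr hrl
    rcases Finset.mem_insert.mp he with rfl | he
    · have := Finset.mem_Icc.mp (lastHook_mem_Icc (lam := lam) hr hrl)
      rw [Finset.mem_Icc]
      omega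
    · obtain ⟨j, hj, rfl⟩ := Finset.mem_image.mp he
      simp only [Finset.mem_filter, Finset.mem_Icc] at hj ⊢
      have := hanti r j hr hj.2.le hj.1.2
      omega
  · intro h
    obtain ⟨j, hj, hje⟩ := Finset.mem_image.mp h
    simp only [Finset.mem_filter, Finset.mem_Icc] at hj
    exact lastHook_ne hanti hr hj.2 hj.1.2 hje.symm

/-- For a partition `λ_1 ≥ ⋯ ≥ λ_l > 0` and an integer `q ≥ 2`,
`∏_s ψ_{λ'_s - λ'_{s+1}}(q) · ∏_{i<j} (q^{λ(i)-λ(j)} - 1)` divides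
`∏_r ψ_{λ(r)+l}(q)`; equivalently `Φ(λ, q)` is an integer. -/
theorem Phi_integral (l : ℕ) (lam : ℕ → ℕ)
    (hpos : ∀ i, 1 ≤ i → i ≤ l → 0 < lam i)
    (hanti : ∀ i j, 1 ≤ i → i ≤ j → j ≤ l → lam j ≤ lam i)
    (q : ℤ) (hq : 2 ≤ q) :
    ((∏ s ∈ Finset.Icc 1 (lam 1), psi q (conjPart lam l s - conjPart lam l (s + 1))) *
        ∏ ij ∈ (Finset.Icc 1 l ×ˢ Finset.Icc 1 l).filter fun ij => ij.1 < ij.2,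
          (q ^ (lam ij.1 + ij.2 - (lam ij.2 + ij.1)) - 1)) ∣
      ∏ r ∈ Finset.Icc 1 l, psi q (lam r + l - r) := by
  rw [prod_psi_conjPart l lam hpos hanti, Finset.prod_filter, Finset.prod_product,
    ← Finset.prod_mul_distrib]
  refine Finset.prod_dvd_prod_of_dvd _ _ fun r hr => ?_
  rw [← Finset.prod_filter]
  rw [Finset.mem_Icc] at hr
  exact row_dvd_psi hpos hanti q hr.1 hr.2
end

section
/- Let λ = (λ_1 ≥ ⋯ ≥ λ_l > 0) be a nonempty partition and let x ≥ λ_1 be an integer. Then the l + 1 integers x − λ(1), …, x − λ(l), λ'_x + 1 are pairwise distinct, positive, and all less than or equal to x + l. -/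
theorem conjPart_le (lam : ℕ → ℕ) (l s : ℕ) : conjPart lam l s ≤ l := by
  simpa [conjPart] using Finset.card_filter_le (Finset.Icc 1 l) fun i => s ≤ lam i

/-- Conjugation is a Galois connection: `i ≤ λ'_s` if and only if `s ≤ λ_i`. -/
theorem le_conjPart_iff {l : ℕ} {lam : ℕ → ℕ}
    (hanti : ∀ i j, 1 ≤ i → i ≤ j → j ≤ l → lam j ≤ lam i)
    {i : ℕ} (hi : 1 ≤ i) (hil : i ≤ l) (s : ℕ) : i ≤ conjPart lam l s ↔ s ≤ lam i := by
  constructor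
  · intro h
    by_contra! hlt
    have hsub : ((Finset.Icc 1 l).filter fun j => s ≤ lam j) ⊆ Finset.Icc 1 (i - 1) := by
      intro j hj
      simp only [Finset.mem_filter, Finset.mem_Icc] at hj ⊢
      refine ⟨hj.1.1, ?_⟩
      by_contra! hji
      have := hanti i j hi (by omega) hj.1.2
      omega
    have hcard := Finset.card_le_card hsub
    rw [Nat.card_Icc] at hcard
    unfold conjPart at h
    omega
  · intro h
    have hsub : Finset.Icc 1 i ⊆ (Finset.Icc 1 l).filter fun j => s ≤ lam j := by
      intro j hj
      simp only [Finset.mem_filter, Finset.mem_Icc] at hj ⊢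
      exact ⟨⟨hj.1, hj.2.trans hil⟩, h.trans (hanti j i hj.1 hj.2 hil)⟩
    simpa [conjPart] using Finset.card_le_card hsub

/-- For a nonempty partition `λ_1 ≥ ⋯ ≥ λ_l > 0` and `x ≥ λ_1`, the `l + 1` integers
`x - λ(1), …, x - λ(l), λ'_x + 1` are pairwise distinct, positive and at most `x + l`.
Here `x + i - lam i = x - λ(i)`. -/
theorem distinct_exponents (l : ℕ) (hl : 1 ≤ l) (lam : ℕ → ℕ)
    (hpos : ∀ i, 1 ≤ i → i ≤ l → 0 < lam i)
    (hanti : ∀ i j, 1 ≤ i → i ≤ j → j ≤ l → lam j ≤ lam i)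
    (x : ℕ) (hx : lam 1 ≤ x) :
    (∀ i ∈ Finset.Icc 1 l, 0 < x + i - lam i ∧ x + i - lam i ≤ x + l) ∧
    (0 < conjPart lam l x + 1 ∧ conjPart lam l x + 1 ≤ x + l) ∧
    Set.InjOn (fun i => x + i - lam i) (Finset.Icc 1 l : Finset ℕ) ∧
    (∀ i ∈ Finset.Icc 1 l, x + i - lam i ≠ conjPart lam l x + 1) := by
  have hle : ∀ i, 1 ≤ i → i ≤ l → lam i ≤ x := fun i hi hil =>
    (hanti 1 i le_rfl hi hil).trans hx
  have hc := conjPart_le lam l x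
  have h1 := hpos 1 le_rfl hl
  refine ⟨?_, ⟨by omega, by omega⟩, ?_, ?_⟩
  · intro i hi
    rw [Finset.mem_Icc] at hi
    have := hle i hi.1 hi.2
    have := hpos i hi.1 hi.2
    omega
  · intro i hi j hj hij
    rw [Finset.mem_coe, Finset.mem_Icc] at hi hj
    have := hle i hi.1 hi.2
    have := hle j hj.1 hj.2
    dsimp only at hij
    rcases le_total i j with h | h
    · have := hanti i j hi.1 h hj.2
      omega
    · have := hanti j i hj.1 h hi.2
      omega
  · intro i hi
    rw [Finset.mem_Icc] at hi
    have := hle i hi.1 hi.2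
    have := le_conjPart_iff hanti hi.1 hi.2 x
    omega
end

section
/- Let λ = (λ_1 ≥ ⋯ ≥ λ_l > 0) be a nonempty partition, let x ≥ λ_1 be an integer, and let q ≥ 2 be an integer. Then (q^{λ'_x + 1} − 1) · ∏_{i=1}^{l} (q^{x − λ(i)} − 1) divides ψ_{x+l}(q). -/
/-- `i ≤ λ'_s` whenever `s ≤ λ_i`. -/
lemma le_conjPart (l : ℕ) (lam : ℕ → ℕ)
    (hanti : ∀ i j, 1 ≤ i → i ≤ j → j ≤ l → lam j ≤ lam i)
    {s i : ℕ} (hil : i ≤ l) (hs : s ≤ lam i) : i ≤ conjPart lam l s := by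
  have hsub : Finset.Icc 1 i ⊆ (Finset.Icc 1 l).filter fun j => s ≤ lam j := by
    intro j hj
    rw [Finset.mem_Icc] at hj
    rw [Finset.mem_filter, Finset.mem_Icc]
    exact ⟨⟨hj.1, hj.2.trans hil⟩, hs.trans (hanti j i hj.1 hj.2 hil)⟩
  simpa [conjPart] using Finset.card_le_card hsub

/-- `λ'_s < i` whenever `λ_i < s`. -/
lemma conjPart_lt (l : ℕ) (lam : ℕ → ℕ)
    (hanti : ∀ i j, 1 ≤ i → i ≤ j → j ≤ l → lam j ≤ lam i)
    {s i : ℕ} (hi : 1 ≤ i) (hs : lam i < s) : conjPart lam l s < i := by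
  have hsub : ((Finset.Icc 1 l).filter fun j => s ≤ lam j) ⊆ Finset.Icc 1 (i - 1) := by
    intro j hj
    rw [Finset.mem_filter, Finset.mem_Icc] at hj
    rw [Finset.mem_Icc]
    by_contra hcon
    have := hanti i j hi (by omega) hj.1.2
    omega
  have hcard := Finset.card_le_card hsub
  rw [Nat.card_Icc] at hcard
  unfold conjPart
  omega

/-- For a nonempty partition `λ_1 ≥ ⋯ ≥ λ_l > 0`, an integer `x ≥ λ_1` and an integer
`q ≥ 2`, `(q^{λ'_x + 1} - 1) · ∏_{i=1}^l (q^{x - λ(i)} - 1)` divides `ψ_{x+l}(q)`.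
Here `x + i - lam i = x - λ(i)`. -/
theorem exponents_divisibility (l : ℕ) (hl : 1 ≤ l) (lam : ℕ → ℕ)
    (hpos : ∀ i, 1 ≤ i → i ≤ l → 0 < lam i)
    (hanti : ∀ i j, 1 ≤ i → i ≤ j → j ≤ l → lam j ≤ lam i)
    (x : ℕ) (hx : lam 1 ≤ x) (q : ℤ) (hq : 2 ≤ q) :
    (q ^ (conjPart lam l x + 1) - 1) *
        ∏ i ∈ Finset.Icc 1 l, (q ^ (x + i - lam i) - 1) ∣
      psi q (x + l) := by
  have hle : ∀ i, 1 ≤ i → i ≤ l → lam i ≤ x := fun i h1 h2 =>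
    (hanti 1 i le_rfl h1 h2).trans hx
  have hk : conjPart lam l x ≤ l := by
    simpa [conjPart] using
      Finset.card_filter_le (Finset.Icc 1 l) (fun i => x ≤ lam i)
  have hinj : Set.InjOn (fun i => x + i - lam i) (Finset.Icc 1 l : Finset ℕ) := by
    intro i hi j hj hij
    rw [Finset.mem_coe, Finset.mem_Icc] at hi hj
    have h1 := hle i hi.1 hi.2
    have h2 := hle j hj.1 hj.2
    dsimp only at hij
    rcases le_total i j with h | h
    · have := hanti i j hi.1 h hj.2
      omega
    · have := hanti j i hj.1 h hi.2
      omega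
  have hnot : conjPart lam l x + 1 ∉ (Finset.Icc 1 l).image fun i => x + i - lam i := by
    rw [Finset.mem_image]
    rintro ⟨i, hi, h⟩
    rw [Finset.mem_Icc] at hi
    have h1 := hle i hi.1 hi.2
    rcases lt_or_ge (lam i) x with hlt | hge
    · have := conjPart_lt l lam hanti hi.1 hlt
      omega
    · have := le_conjPart l lam hanti hi.2 hge
      omega
  rw [← Finset.prod_image (f := fun e => q ^ e - 1) hinj,
    ← Finset.prod_insert (f := fun e => q ^ e - 1) hnot]
  refine Finset.prod_dvd_prod_of_subset _ _ _ fun e he => ?_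
  rw [Finset.mem_insert, Finset.mem_image] at he
  rw [Finset.mem_Icc]
  rcases he with rfl | ⟨i, hi, rfl⟩
  · have := hpos 1 le_rfl hl
    omega
  · rw [Finset.mem_Icc] at hi
    have := hle i hi.1 hi.2
    omega
end

section
/- For every prime p, every positive integer e, and q = p^e, the p-adic valuation of the nonzero rational number h(GL_2(F_q)) equals e·(q − 1)(q − 2), where F_q denotes the finite field with q elements. -/
/-- The set of pairs (χ, d) where χ is the character of an irreducible (simple) complex
representation of `G` and `d` is its degree. Distinct irreducible characters correspond to
distinct isomorphism classes, so this set is in bijection with `Irr(G)`. -/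
noncomputable def irrCharDegSet (G : Type) [Group G] : Set ((G → ℂ) × ℕ) :=
  {p | ∃ V : FDRep ℂ G, CategoryTheory.Simple V ∧ p.1 = V.character ∧ p.2 = Module.finrank ℂ V}

/-- `h(G)`: the product of the sizes of all conjugacy classes of `G` divided by the
product of the degrees of all irreducible complex characters of `G`. -/
noncomputable def groupH (G : Type) [Group G] : ℚ :=
  (∏ᶠ c : ConjClasses G, (c.carrier.ncard : ℚ)) / (∏ᶠ p ∈ irrCharDegSet G, (p.2 : ℚ))

section IrreducibleRepresentations

variable {G V : Type*} [Group G] [AddCommGroup V] [Module ℂ V]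

open Module in
/-- A family of commuting endomorphisms preserving a nonzero subspace has a common eigenvector
in that subspace. -/
theorem exists_common_eigenvector [FiniteDimensional ℂ V] {ι : Type*} (f : ι → Module.End ℂ V)
    (W : Submodule ℂ V) (hW : W ≠ ⊥) (hinv : ∀ i, ∀ v ∈ W, f i v ∈ W)
    (hcomm : ∀ i j, ∀ v ∈ W, f i (f j v) = f j (f i v)) :
    ∃ v ∈ W, v ≠ 0 ∧ ∀ i, ∃ c : ℂ, f i v = c • v := by
  induction hn : finrank ℂ W using Nat.strong_induction_on generalizing W with
  | _ n ih =>
  by_cases hscal : ∀ i, ∃ c : ℂ, ∀ v ∈ W, f i v = c • v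
  · obtain ⟨v, hv, hv0⟩ := W.ne_bot_iff.mp hW
    exact ⟨v, hv, hv0, fun i => (hscal i).imp fun c hc => hc v hv⟩
  push Not at hscal
  obtain ⟨i, hi⟩ := hscal
  have : Nontrivial W := (Submodule.nontrivial_iff_ne_bot).mpr hW
  obtain ⟨c, hc⟩ := Module.End.exists_eigenvalue ((f i).restrict (hinv i))
  obtain ⟨⟨v, hv⟩, hvc⟩ := hc.exists_hasEigenvector
  have hvc1 : f i v = c • v := by simpa [Subtype.ext_iff] using hvc.apply_eq_smul
  have hv0 : v ≠ 0 := by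
    have := hvc.2
    simpa [Subtype.ext_iff] using this
  let W' : Submodule ℂ V := W ⊓ Module.End.eigenspace (f i) c
  have hlt : W' < W := by
    refine lt_of_le_of_ne inf_le_left fun h => ?_
    obtain ⟨u, hu, hu'⟩ := hi c
    have : u ∈ W' := h ▸ hu
    exact hu' (Module.End.mem_eigenspace_iff.mp this.2)
  obtain ⟨u, hu, hu0, h⟩ := ih _ (hn ▸ Submodule.finrank_lt_finrank_of_lt hlt) W'
    ((Submodule.ne_bot_iff _).mpr ⟨v, ⟨hv, Module.End.mem_eigenspace_iff.mpr hvc1⟩, hv0⟩)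
    (fun j u hu => ⟨hinv j u hu.1, Module.End.mem_eigenspace_iff.mpr (by
      rw [hcomm i j u hu.1, Module.End.mem_eigenspace_iff.mp hu.2, map_smul])⟩)
    (fun a b u hu => hcomm a b u hu.1) rfl
  exact ⟨u, hu.1, hu0, h⟩

namespace Representation

variable {ρ : Representation ℂ G V}

theorem IsIrreducible.eq_top (hρ : ρ.IsIrreducible) (W : Submodule ℂ V)
    (hW : ∀ g, ∀ v ∈ W, ρ g v ∈ W) (h0 : W ≠ ⊥) : W = ⊤ := by
  rcases hρ.eq_bot_or_eq_top ⟨W, fun g v hv => hW g v hv⟩ with h | h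
  · exact absurd (congrArg Subrepresentation.toSubmodule h) h0
  · exact congrArg Subrepresentation.toSubmodule h

theorem IsIrreducible.nontrivial (hρ : ρ.IsIrreducible) : Nontrivial V := by
  by_contra h
  rw [not_nontrivial_iff_subsingleton] at h
  refine hρ.toNontrivial.exists_pair_ne.elim fun a ⟨b, hab⟩ => hab ?_
  exact Subrepresentation.toSubmodule_injective (Subsingleton.elim _ _)

theorem IsIrreducible.span_orbit (hρ : ρ.IsIrreducible) {v : V} (hv : v ≠ 0) :
    Submodule.span ℂ (Set.range fun g => ρ g v) = ⊤ := by
  refine hρ.eq_top _ (fun g u hu => ?_) fun h => ?_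
  · have : Submodule.span ℂ (Set.range fun g => ρ g v) ≤
        (Submodule.span ℂ (Set.range fun g => ρ g v)).comap (ρ g) := by
      rw [Submodule.span_le]
      rintro _ ⟨h, rfl⟩
      exact Submodule.subset_span ⟨g * h, by simp⟩
    exact this hu
  · have : v ∈ Submodule.span ℂ (Set.range fun g => ρ g v) :=
      Submodule.subset_span ⟨1, by simp⟩
    rw [h] at this
    exact hv this

theorem IsIrreducible.range_eq_span (hρ : ρ.IsIrreducible) (e : Module.End ℂ V) {v : V}
    (hv : v ≠ 0) :
    LinearMap.range e = Submodule.span ℂ (Set.range fun g => e (ρ g v)) := by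
  rw [← Submodule.map_top, ← hρ.span_orbit hv, Submodule.map_span, ← Set.range_comp]
  rfl

/-- If the operators `e (ρ g) e` commute, for an idempotent `e` and an irreducible
representation `ρ`, then `e` has rank at most one. -/
theorem IsIrreducible.finrank_range_le_one [FiniteDimensional ℂ V] (hρ : ρ.IsIrreducible)
    (e : Module.End ℂ V) (he : IsIdempotentElem e)
    (hcomm : ∀ g h, e * ρ g * e * ρ h * e = e * ρ h * e * ρ g * e) :
    Module.finrank ℂ (LinearMap.range e) ≤ 1 := by
  by_cases h0 : LinearMap.range e = ⊥
  · rw [h0, finrank_bot]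
    exact zero_le_one
  have hfix : ∀ v ∈ LinearMap.range e, e v = v := by
    rintro _ ⟨u, rfl⟩
    exact LinearMap.congr_fun he.eq u
  obtain ⟨v, hv, hv0, hev⟩ := exists_common_eigenvector (fun g => e * ρ g) (LinearMap.range e) h0
    (fun g v _ => ⟨_, rfl⟩) (fun g h v hv => by
      have := LinearMap.congr_fun (hcomm g h) v
      simpa [hfix v hv] using this)
  rw [hρ.range_eq_span e hv0]
  refine (Submodule.finrank_mono (t := Submodule.span ℂ {v}) ?_).trans
    (finrank_span_singleton hv0).le
  rw [Submodule.span_le]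
  rintro _ ⟨g, rfl⟩
  obtain ⟨c, hc⟩ := hev g
  exact Submodule.mem_span_singleton.mpr ⟨c, hc.symm⟩

/-- An operator commuting with an irreducible representation is scalar. -/
theorem IsIrreducible.exists_eq_smul_one [FiniteDimensional ℂ V] (hρ : ρ.IsIrreducible)
    (A : Module.End ℂ V) (hA : ∀ g, A * ρ g = ρ g * A) : ∃ c : ℂ, A = c • 1 := by
  have := hρ.nontrivial
  obtain ⟨c, hc⟩ := Module.End.exists_eigenvalue A
  have htop := hρ.eq_top (Module.End.eigenspace A c) (fun g v hv => by
    rw [Module.End.mem_eigenspace_iff] at hv ⊢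
    have := LinearMap.congr_fun (hA g) v
    simp only [Module.End.mul_apply] at this
    rw [this, hv, map_smul]) hc
  refine ⟨c, LinearMap.ext fun v => ?_⟩
  have : v ∈ Module.End.eigenspace A c := htop ▸ Submodule.mem_top
  simpa using Module.End.mem_eigenspace_iff.mp this

/-- The character of an irreducible representation is recovered from any operator by averaging
over the group. -/
theorem IsIrreducible.card_mul_trace_mul_character [FiniteDimensional ℂ V] [Fintype G]
    (hρ : ρ.IsIrreducible) (A : Module.End ℂ V) (g : G) :
    (Fintype.card G : ℂ) * LinearMap.trace ℂ V A * ρ.character g =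
      Module.finrank ℂ V * ∑ h : G, LinearMap.trace ℂ V (ρ (h * g * h⁻¹) * A) := by
  obtain ⟨c, hc⟩ := hρ.exists_eq_smul_one (∑ h : G, ρ h⁻¹ * A * ρ h) (fun g => by
    rw [Finset.sum_mul, Finset.mul_sum]
    refine Fintype.sum_equiv (Equiv.mulRight g) _ _ fun h => ?_
    simp only [Equiv.coe_mulRight, mul_inv_rev, map_mul, ← mul_assoc]
    rw [← map_mul ρ g g⁻¹]
    simp)
  have h1 : (Fintype.card G : ℂ) * LinearMap.trace ℂ V A = c * Module.finrank ℂ V := by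
    have := congrArg (LinearMap.trace ℂ V) hc
    rw [map_sum, map_smul, LinearMap.trace_one, smul_eq_mul] at this
    rw [← this, Finset.sum_congr rfl fun h _ => ?_, Finset.sum_const, Finset.card_univ,
      nsmul_eq_mul]
    rw [LinearMap.trace_mul_cycle, ← map_mul, mul_inv_cancel, map_one, one_mul]
  have h2 : ∑ h : G, LinearMap.trace ℂ V (ρ (h * g * h⁻¹) * A) = c * ρ.character g := by
    have := congrArg (fun B => LinearMap.trace ℂ V (ρ g * B)) hc
    simp only [Finset.mul_sum, map_sum, mul_smul_comm, map_smul, mul_one, smul_eq_mul] at this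
    rw [character, ← this]
    refine Finset.sum_congr rfl fun h _ => ?_
    rw [map_mul ρ, map_mul ρ, mul_assoc, mul_assoc, LinearMap.trace_mul_comm]
    simp only [mul_assoc]
  rw [h1, h2]
  ring

end Representation

end IrreducibleRepresentations

namespace GL2

variable {k : Type*} [Field k]

open Matrix

/-- The invertible matrix with given entries and nonzero determinant. -/
noncomputable def mat (a b c d : k) (h : a * d - b * c ≠ 0) : GL (Fin 2) k :=
  GeneralLinearGroup.mkOfDetNeZero !![a, b; c, d] (by simpa [det_fin_two] using h)

@[simp]
theorem coe_mat (a b c d : k) (h : a * d - b * c ≠ 0) :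
    (mat a b c d h : Matrix (Fin 2) (Fin 2) k) = !![a, b; c, d] := rfl

theorem ext {g h : GL (Fin 2) k} (h00 : g 0 0 = h 0 0) (h01 : g 0 1 = h 0 1)
    (h10 : g 1 0 = h 1 0) (h11 : g 1 1 = h 1 1) : g = h := by
  ext i j
  fin_cases i <;> fin_cases j <;> assumption

theorem det_ne_zero (g : GL (Fin 2) k) : g 0 0 * g 1 1 - g 0 1 * g 1 0 ≠ 0 := by
  have := g.det_ne_zero
  rwa [det_fin_two] at this

/-- Upper unipotent matrices. -/
noncomputable def u (x : k) : GL (Fin 2) k := mat 1 x 0 1 (by simp)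

/-- Diagonal matrices. -/
noncomputable def dg (a d : kˣ) : GL (Fin 2) k := mat a 0 0 d (by simp)

/-- The Weyl element. -/
noncomputable def w : GL (Fin 2) k := mat 0 1 (-1) 0 (by simp)

/-- Reflection of a matrix in its antidiagonal. -/
noncomputable def flip (g : GL (Fin 2) k) : GL (Fin 2) k :=
  mat (g 1 1) (g 0 1) (g 1 0) (g 0 0) (by rw [mul_comm]; exact det_ne_zero g)

@[simp]
theorem coe_u (x : k) : (u x : Matrix (Fin 2) (Fin 2) k) = !![1, x; 0, 1] := rfl

@[simp]
theorem coe_dg (a d : kˣ) : (dg a d : Matrix (Fin 2) (Fin 2) k) = !![(a : k), 0; 0, (d : k)] := rfl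

@[simp]
theorem coe_w : ((w : GL (Fin 2) k) : Matrix (Fin 2) (Fin 2) k) = !![0, 1; -1, 0] := rfl

@[simp]
theorem coe_flip (g : GL (Fin 2) k) :
    (flip g : Matrix (Fin 2) (Fin 2) k) = !![g 1 1, g 0 1; g 1 0, g 0 0] := rfl

theorem u_mul_u (x y : k) : u x * u y = u (x + y) := by
  apply ext <;> simp [Matrix.mul_apply, Fin.sum_univ_two, add_comm]

theorem u_zero : u (0 : k) = 1 := by
  apply ext <;> simp

theorem dg_mul_dg (a d a' d' : kˣ) : dg a d * dg a' d' = dg (a * a') (d * d') := by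
  apply ext <;> simp [Matrix.mul_apply, Fin.sum_univ_two]

theorem dg_mul_u (a d : kˣ) (x : k) : dg a d * u x = u (a * x / d) * dg a d := by
  apply ext <;> simp [Matrix.mul_apply, Fin.sum_univ_two]

theorem dg_mul_w (a d : kˣ) : dg a d * w = w * dg d a := by
  apply ext <;> simp [Matrix.mul_apply, Fin.sum_univ_two]

theorem flip_mul (g h : GL (Fin 2) k) : flip (g * h) = flip h * flip g := by
  apply ext <;> simp [Matrix.mul_apply, Fin.sum_univ_two] <;> ring

theorem flip_u (x : k) : flip (u x) = u x := by
  apply ext <;> simp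

theorem flip_dg (a d : kˣ) : flip (dg a d) = dg d a := by
  apply ext <;> simp

theorem flip_w_mul_dg (a d : kˣ) : flip (w * dg a d) = w * dg a d := by
  apply ext <;> simp [Matrix.mul_apply, Fin.sum_univ_two]

theorem det_u (x : k) : GeneralLinearGroup.det (u x) = 1 := by
  ext; simp [det_fin_two]

theorem det_dg (a d : kˣ) : GeneralLinearGroup.det (dg a d) = a * d := by
  ext; simp [det_fin_two]

theorem det_w : GeneralLinearGroup.det (w : GL (Fin 2) k) = 1 := by
  ext; simp [det_fin_two]

theorem exists_eq_of_eq_zero {g : GL (Fin 2) k} (hg : g 1 0 = 0) :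
    ∃ (y : k) (a d : kˣ), g = u y * dg a d := by
  have h := det_ne_zero g
  simp only [hg, mul_zero, sub_zero] at h
  have h0 := left_ne_zero_of_mul h
  have h1 := right_ne_zero_of_mul h
  refine ⟨g 0 1 / g 1 1, Units.mk0 _ h0, Units.mk0 _ h1, ?_⟩
  apply ext <;> simp [Matrix.mul_apply, Fin.sum_univ_two, hg]
  field_simp

theorem exists_eq_of_ne_zero {g : GL (Fin 2) k} (hg : g 1 0 ≠ 0) :
    ∃ (y z : k) (a d : kˣ), g = u y * (w * dg a d) * u z := by
  have h := det_ne_zero g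
  refine ⟨g 0 0 / g 1 0, g 1 1 / g 1 0, -Units.mk0 _ hg,
    Units.mk0 (-(g 0 0 * g 1 1 - g 0 1 * g 1 0) / g 1 0) (div_ne_zero (neg_ne_zero.mpr h) hg), ?_⟩
  apply ext <;> simp [Matrix.mul_apply, Fin.sum_univ_two] <;> field_simp
  ring

section WhittakerProjection

variable [Fintype k] {V : Type*} [AddCommGroup V] [Module ℂ V]

open Representation

/-- The projection onto the vectors on which the upper unipotent group acts through `ψ`. -/
noncomputable def proj (ρ : Representation ℂ (GL (Fin 2) k) V) (ψ : AddChar k ℂ) :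
    Module.End ℂ V :=
  (Fintype.card k : ℂ)⁻¹ • ∑ x : k, ψ (-x) • ρ (u x)

variable (ρ : Representation ℂ (GL (Fin 2) k) V) (ψ : AddChar k ℂ)

theorem mul_proj_u (y : k) : ρ (u y) * proj ρ ψ = ψ y • proj ρ ψ := by
  rw [proj, mul_smul_comm, smul_comm (ψ y), Finset.mul_sum, Finset.smul_sum (r := ψ y)]
  refine congrArg _ (Fintype.sum_equiv (Equiv.addLeft y) _ _ fun x => ?_)
  rw [mul_smul_comm, ← map_mul ρ, u_mul_u, smul_smul, ← AddChar.map_add_eq_mul ψ]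
  simp

theorem proj_mul_u (y : k) : proj ρ ψ * ρ (u y) = ψ y • proj ρ ψ := by
  rw [proj, smul_mul_assoc, smul_comm (ψ y), Finset.sum_mul, Finset.smul_sum (r := ψ y)]
  refine congrArg _ (Fintype.sum_equiv (Equiv.addRight y) _ _ fun x => ?_)
  rw [smul_mul_assoc, ← map_mul ρ, u_mul_u, smul_smul, ← AddChar.map_add_eq_mul ψ]
  simp

theorem proj_mul_u_mul (y : k) (A : Module.End ℂ V) :
    proj ρ ψ * (ρ (u y) * A) = ψ y • (proj ρ ψ * A) := by
  rw [← mul_assoc, proj_mul_u, smul_mul_assoc]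

theorem proj_mul_u_mul_u_mul_proj (y z : k) (n : GL (Fin 2) k) :
    proj ρ ψ * ρ (u y * n * u z) * proj ρ ψ = (ψ y * ψ z) • (proj ρ ψ * ρ n * proj ρ ψ) := by
  simp only [map_mul ρ, mul_assoc, mul_proj_u, proj_mul_u_mul, mul_smul_comm, smul_mul_assoc,
    smul_smul]

theorem proj_mul_self : proj ρ ψ * proj ρ ψ = proj ρ ψ := by
  conv_lhs => enter [1]; rw [proj]
  simp only [smul_mul_assoc, Finset.sum_mul, mul_proj_u, smul_smul, ← AddChar.map_add_eq_mul]
  simp [← Nat.cast_smul_eq_nsmul ℂ, smul_smul]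

theorem mem_range_proj_one {v : V} : v ∈ LinearMap.range (proj ρ 1) ↔ ∀ x, ρ (u x) v = v := by
  constructor
  · rintro ⟨v, rfl⟩ x
    simpa using LinearMap.congr_fun (mul_proj_u ρ 1 x) v
  · intro h
    refine ⟨v, ?_⟩
    simp [proj, h, ← Nat.cast_smul_eq_nsmul ℂ, smul_smul]

theorem trace_proj [FiniteDimensional ℂ V] :
    LinearMap.trace ℂ V (proj ρ ψ) = Module.finrank ℂ (LinearMap.range (proj ρ ψ)) :=
  (LinearMap.IsIdempotentElem.isProj_range _ (proj_mul_self ρ ψ)).trace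

omit [Fintype k] in
theorem character_u {x : k} (hx : x ≠ 0) : ρ.character (u x) = ρ.character (u 1) := by
  have : u x = dg (Units.mk0 x hx) 1 * u 1 * (dg (Units.mk0 x hx) 1)⁻¹ := by
    rw [eq_mul_inv_iff_mul_eq, dg_mul_u]
    simp
  rw [this, char_conj]

theorem card_mul_finrank_range_proj [FiniteDimensional ℂ V] :
    (Fintype.card k : ℂ) * Module.finrank ℂ (LinearMap.range (proj ρ ψ)) =
      (Module.finrank ℂ V - ρ.character (u 1)) + (∑ x, ψ x) * ρ.character (u 1) := by
  classical
  have h1 : ∑ x : k, ψ (-x) = ∑ x, ψ x := Fintype.sum_equiv (Equiv.neg k) _ _ fun _ => rfl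
  rw [← trace_proj, proj, map_smul, smul_eq_mul, mul_inv_cancel_left₀ (by simp), map_sum, ← h1,
    ← Finset.add_sum_erase _ _ (Finset.mem_univ (0 : k)),
    ← Finset.add_sum_erase _ _ (Finset.mem_univ (0 : k)), add_mul, Finset.sum_mul,
    Finset.sum_congr (g := fun x => ψ (-x) * ρ.character (u 1)) rfl fun x hx => by
      rw [← character_u ρ (Finset.ne_of_mem_erase hx), map_smul, smul_eq_mul, character]]
  simp only [u_zero, neg_zero, AddChar.map_zero_eq_one, one_smul, map_one, LinearMap.trace_one,
    one_mul]
  ring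

theorem finrank_eq_add [FiniteDimensional ℂ V] (hψ : ψ ≠ 1) :
    Module.finrank ℂ V = Module.finrank ℂ (LinearMap.range (proj ρ 1)) +
      (Fintype.card k - 1) * Module.finrank ℂ (LinearMap.range (proj ρ ψ)) := by
  have h1 := card_mul_finrank_range_proj ρ 1
  have h2 := card_mul_finrank_range_proj ρ ψ
  rw [AddChar.sum_eq_zero_of_ne_one hψ] at h2
  have hq : (Fintype.card k : ℂ) ≠ 0 := by simp
  have hq1 : 1 ≤ Fintype.card k := Fintype.card_pos
  rw [← Nat.cast_inj (R := ℂ)]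
  push_cast [Nat.cast_sub hq1]
  simp at h1
  refine mul_left_cancel₀ hq ?_
  linear_combination -h1 - (Fintype.card k - 1 : ℂ) * h2

theorem proj_mul_dg_mul_proj (hψ : ψ ≠ 1) {a d : kˣ} (had : a ≠ d) :
    proj ρ ψ * ρ (dg a d) * proj ρ ψ = 0 := by
  obtain ⟨x, hx⟩ := (AddChar.ne_one_iff (ψ := ψ)).mp hψ
  have hne : (a / d : k) - 1 ≠ 0 := by
    rw [sub_ne_zero, Ne, div_eq_one_iff_eq (by simp)]
    exact fun h => had (Units.ext h)
  set y : k := x / (a / d - 1) with hy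
  have hxy : x = a * y / d - y := by
    rw [hy, mul_div_right_comm, ← sub_one_mul, mul_div_cancel₀ _ hne]
  have h : ψ y • (proj ρ ψ * ρ (dg a d) * proj ρ ψ) =
      ψ (a * y / d) • (proj ρ ψ * ρ (dg a d) * proj ρ ψ) := by
    rw [← mul_smul_comm, ← mul_proj_u, mul_assoc, ← mul_assoc (ρ (dg a d)), ← map_mul ρ, dg_mul_u,
      map_mul ρ, mul_assoc, proj_mul_u_mul, mul_assoc]
  rw [← sub_eq_zero, ← sub_smul, smul_eq_zero] at h
  refine h.resolve_left fun h => hx ?_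
  rw [hxy, AddChar.map_sub_eq_div, ← sub_eq_zero.mp h, div_self]
  exact (AddChar.val_isUnit ψ y).ne_zero

theorem proj_mul_flip_mul_proj (hψ : ψ ≠ 1) (g : GL (Fin 2) k) :
    proj ρ ψ * ρ (flip g) * proj ρ ψ = proj ρ ψ * ρ g * proj ρ ψ := by
  by_cases hg : g 1 0 = 0
  · obtain ⟨y, a, d, rfl⟩ := exists_eq_of_eq_zero hg
    by_cases had : a = d
    · congr 3
      subst had
      rw [flip_mul, flip_u, flip_dg, dg_mul_u]
      simp
    · have h1 := proj_mul_u_mul_u_mul_proj ρ ψ y 0 (dg a d)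
      have h2 := proj_mul_u_mul_u_mul_proj ρ ψ 0 y (dg d a)
      rw [proj_mul_dg_mul_proj ρ ψ hψ had, smul_zero, u_zero, mul_one] at h1
      rw [proj_mul_dg_mul_proj ρ ψ hψ (Ne.symm had), smul_zero, u_zero, one_mul] at h2
      rw [flip_mul, flip_u, flip_dg, h1, h2]
  · obtain ⟨y, z, a, d, rfl⟩ := exists_eq_of_ne_zero hg
    rw [flip_mul, flip_mul, flip_u, flip_u, flip_w_mul_dg, ← mul_assoc,
      proj_mul_u_mul_u_mul_proj, proj_mul_u_mul_u_mul_proj, mul_comm (ψ z)]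

theorem finrank_range_proj_le_one [FiniteDimensional ℂ V] (hρ : ρ.IsIrreducible) (hψ : ψ ≠ 1) :
    Module.finrank ℂ (LinearMap.range (proj ρ ψ)) ≤ 1 := by
  have key : ∀ g h, proj ρ ψ * ρ g * proj ρ ψ * ρ h * proj ρ ψ = (Fintype.card k : ℂ)⁻¹ •
      ∑ x : k, ψ (-x) • (proj ρ ψ * ρ (g * u x * h) * proj ρ ψ) := by
    intro g h
    conv_lhs => rw [mul_assoc (_ * _), mul_assoc (proj ρ ψ * ρ g)]; enter [2, 1]; rw [proj]
    simp only [mul_smul_comm, smul_mul_assoc, Finset.mul_sum, Finset.sum_mul, map_mul ρ, mul_assoc]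
  refine hρ.finrank_range_le_one _ (proj_mul_self ρ ψ) fun g h => ?_
  rw [key g h, Finset.sum_congr rfl fun x _ => by
    rw [← proj_mul_flip_mul_proj ρ ψ hψ, flip_mul, flip_mul, flip_u, ← mul_assoc], ← key]
  have h1 := proj_mul_flip_mul_proj ρ ψ hψ g
  rw [proj_mul_flip_mul_proj ρ ψ hψ]
  simp only [mul_assoc] at h1 ⊢
  rw [h1]

end WhittakerProjection

end GL2

namespace GL2

open Matrix Representation

variable {k : Type*} [Field k]

theorem inv_w_mul_u_mul_w (x : k) : w⁻¹ * u x * w = mat 1 0 (-x) 1 (by simp) := by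
  rw [mul_assoc, inv_mul_eq_iff_eq_mul]
  apply ext <;> simp [Matrix.mul_apply, Fin.sum_univ_two]

theorem inv_w : (w : GL (Fin 2) k)⁻¹ = mat 0 (-1) 1 0 (by simp) := by
  rw [inv_eq_iff_mul_eq_one]
  apply ext <;> simp [Matrix.mul_apply, Fin.sum_univ_two]

theorem w_eq : (w : GL (Fin 2) k) = u 1 * (w⁻¹ * u 1 * w) * u 1 := by
  rw [inv_w_mul_u_mul_w]
  apply ext <;> simp [Matrix.mul_apply, Fin.sum_univ_two]

variable [Fintype k] {V : Type*} [AddCommGroup V] [Module ℂ V]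
  (ρ : Representation ℂ (GL (Fin 2) k) V)

theorem dg_mul_proj_one (a d : kˣ) : ρ (dg a d) * proj ρ 1 = proj ρ 1 * ρ (dg a d) := by
  rw [proj, mul_smul_comm, smul_mul_assoc, Finset.mul_sum, Finset.sum_mul]
  refine congrArg _ (Fintype.sum_equiv (Units.mulLeft (a / d)) _ _ fun x => ?_)
  simp only [AddChar.one_apply, one_smul, ← map_mul ρ, dg_mul_u]
  congr 3
  simp
  ring

/-- A nonzero vector fixed by the upper unipotent group and spanning a line stable under the
diagonal matrices. -/
structure IsBorelEigenvector (χ : kˣ → kˣ → ℂ) (v : V) : Prop where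
  ne_zero : v ≠ 0
  u_apply : ∀ x, ρ (u x) v = v
  dg_apply : ∀ a d, ρ (dg a d) v = χ a d • v

variable {ρ}

theorem exists_isBorelEigenvector [FiniteDimensional ℂ V]
    (h : LinearMap.range (proj ρ 1) ≠ ⊥) : ∃ χ v, IsBorelEigenvector ρ χ v := by
  obtain ⟨v, hv, hv0, hvχ⟩ := exists_common_eigenvector (fun t : kˣ × kˣ => ρ (dg t.1 t.2)) _ h
    (by
      rintro ⟨a, d⟩ v hv
      rw [mem_range_proj_one] at hv ⊢
      intro x
      have : u x * dg a d = dg a d * u (d * x / a) := by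
        rw [dg_mul_u]
        congr 2
        field_simp
      rw [← Module.End.mul_apply, ← map_mul, this, map_mul, Module.End.mul_apply, hv])
    (by
      rintro ⟨a, d⟩ ⟨a', d'⟩ v -
      simp only [← Module.End.mul_apply, ← map_mul, dg_mul_dg, mul_comm])
  choose χ hχ using hvχ
  exact ⟨fun a d => χ (a, d), v, hv0, (mem_range_proj_one ρ).mp hv, fun a d => hχ (a, d)⟩

namespace IsBorelEigenvector

variable {χ : kˣ → kˣ → ℂ} {v : V} (hv : IsBorelEigenvector ρ χ v)

include hv

theorem proj_apply : proj ρ 1 v = v := by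
  obtain ⟨u, rfl⟩ := (mem_range_proj_one ρ).mpr hv.u_apply
  exact LinearMap.congr_fun (proj_mul_self ρ 1) u

omit [Fintype k] in
theorem apply_of_eq_zero {g : GL (Fin 2) k} (hg : g 1 0 = 0) :
    ∃ a d : kˣ, a * d = GeneralLinearGroup.det g ∧ ρ g v = χ a d • v := by
  obtain ⟨y, a, d, rfl⟩ := exists_eq_of_eq_zero hg
  refine ⟨a, d, ?_, ?_⟩
  · rw [map_mul, det_u, det_dg, one_mul]
  · rw [map_mul, Module.End.mul_apply, hv.dg_apply, map_smul, hv.u_apply]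

theorem proj_apply_of_ne_zero {g : GL (Fin 2) k} (hg : g 1 0 ≠ 0) :
    ∃ a d : kˣ, a * d = GeneralLinearGroup.det g ∧
      proj ρ 1 (ρ g v) = χ a d • proj ρ 1 (ρ w v) := by
  obtain ⟨y, z, a, d, rfl⟩ := exists_eq_of_ne_zero hg
  refine ⟨a, d, ?_, ?_⟩
  · simp [det_u, det_dg, det_w]
  · have := proj_mul_u ρ 1 y
    rw [AddChar.one_apply, one_smul] at this
    rw [map_mul, map_mul, map_mul, Module.End.mul_apply, hv.u_apply, ← Module.End.mul_apply,
      ← mul_assoc, this, Module.End.mul_apply, Module.End.mul_apply, hv.dg_apply, map_smul,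
      map_smul]

theorem proj_inv_w_proj_w [DecidableEq k] :
    (Fintype.card k : ℂ) • proj ρ 1 (ρ w⁻¹ (proj ρ 1 (ρ w v))) =
    v + ∑ x ∈ Finset.univ.erase (0 : k), proj ρ 1 (ρ (mat 1 0 (-x) 1 (by simp)) v) := by
  have : proj ρ 1 (ρ w v) = (Fintype.card k : ℂ)⁻¹ • ∑ x : k, ρ (u x * w) v := by
    simp [proj]
  rw [this]
  simp only [map_smul, map_sum, smul_smul]
  rw [mul_inv_cancel₀ (by simp), one_smul,
    ← Finset.add_sum_erase _ _ (Finset.mem_univ (0 : k))]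
  congr 1
  · simp only [u_zero, one_mul, ← Module.End.mul_apply, ← map_mul]
    simp [hv.proj_apply]
  · refine Finset.sum_congr rfl fun x _ => ?_
    simp only [← inv_w_mul_u_mul_w, ← Module.End.mul_apply, ← map_mul, mul_assoc]

theorem proj_w_ne_zero : proj ρ 1 (ρ w v) ≠ 0 := by
  classical
  intro h
  have key := hv.proj_inv_w_proj_w
  rw [h, map_zero, map_zero, smul_zero, Finset.sum_eq_zero, add_zero] at key
  · exact hv.ne_zero key.symm
  · intro x hx
    obtain ⟨a, d, -, h'⟩ := hv.proj_apply_of_ne_zero (g := mat 1 0 (-x) 1 (by simp))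
      (by simpa using hx)
    rw [h', h, smul_zero]

theorem range_proj_le [FiniteDimensional ℂ V] (hρ : ρ.IsIrreducible) :
    LinearMap.range (proj ρ 1) ≤ Submodule.span ℂ {v, proj ρ 1 (ρ w v)} := by
  rw [hρ.range_eq_span _ hv.ne_zero, Submodule.span_le]
  rintro _ ⟨g, rfl⟩
  by_cases hg : g 1 0 = 0
  · obtain ⟨a, d, -, h⟩ := hv.apply_of_eq_zero hg
    simp only [h, map_smul, hv.proj_apply]
    exact Submodule.smul_mem _ _ (Submodule.subset_span (by simp))
  · obtain ⟨a, d, -, h⟩ := hv.proj_apply_of_ne_zero hg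
    simp only [h]
    exact Submodule.smul_mem _ _ (Submodule.subset_span (by simp))

theorem finrank_range_proj_le_two [FiniteDimensional ℂ V] (hρ : ρ.IsIrreducible) :
    Module.finrank ℂ (LinearMap.range (proj ρ 1)) ≤ 2 := by
  classical
  refine (Submodule.finrank_mono (hv.range_proj_le hρ)).trans ?_
  have := finrank_span_finset_le_card (R := ℂ) ({v, proj ρ 1 (ρ w v)} : Finset V)
  rw [Finset.coe_pair] at this
  exact this.trans Finset.card_le_two

omit [Fintype k] in
theorem finrank_eq_one_of_trivial [FiniteDimensional ℂ V] (hρ : ρ.IsIrreducible)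
    (h : ∀ x, ρ (u x) = 1) : Module.finrank ℂ V = 1 := by
  have := hρ.nontrivial
  have hw : ρ w = 1 := by
    rw [w_eq]
    simp only [map_mul, h, one_mul, mul_one]
    rw [← map_mul, inv_mul_cancel, map_one]
  refine le_antisymm ?_ Module.finrank_pos
  rw [← finrank_top, ← hρ.span_orbit hv.ne_zero]
  refine (Submodule.finrank_mono (t := Submodule.span ℂ {v}) ?_).trans
    (finrank_span_singleton hv.ne_zero).le
  rw [Submodule.span_le]
  rintro _ ⟨g, rfl⟩
  by_cases hg : g 1 0 = 0
  · obtain ⟨a, d, -, h⟩ := hv.apply_of_eq_zero hg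
    exact Submodule.mem_span_singleton.mpr ⟨_, h.symm⟩
  · obtain ⟨y, z, a, d, rfl⟩ := exists_eq_of_ne_zero hg
    simp only [map_mul, h, hw, one_mul, mul_one]
    exact Submodule.mem_span_singleton.mpr ⟨_, (hv.dg_apply a d).symm⟩

theorem symm_of_finrank_eq_one
    (h1 : Module.finrank ℂ (LinearMap.range (proj ρ 1)) = 1) (a d : kˣ) : χ a d = χ d a := by
  obtain ⟨c, hc⟩ := (finrank_eq_one_iff_of_nonzero' (⟨v, ⟨v, hv.proj_apply⟩⟩ : LinearMap.range _)
    (by simpa [Subtype.ext_iff] using hv.ne_zero)).mp h1 ⟨proj ρ 1 (ρ w v), ⟨_, rfl⟩⟩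
  replace hc : c • v = proj ρ 1 (ρ w v) := congrArg Subtype.val hc
  have h2 : ρ (dg a d) (proj ρ 1 (ρ w v)) = χ d a • proj ρ 1 (ρ w v) := by
    rw [← Module.End.mul_apply, dg_mul_proj_one, Module.End.mul_apply,
      ← Module.End.mul_apply (ρ (dg a d)), ← map_mul, dg_mul_w, map_mul, Module.End.mul_apply,
      hv.dg_apply, map_smul, map_smul]
  rw [← hc, map_smul, hv.dg_apply, smul_comm, hc] at h2
  exact smul_left_injective ℂ hv.proj_w_ne_zero h2

end IsBorelEigenvector

theorem exists_addChar_ne_one (k : Type*) [Field k] [Fintype k] : ∃ ψ : AddChar k ℂ, ψ ≠ 1 := by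
  obtain ⟨ψ, hψ⟩ := AddChar.exists_apply_ne_zero.mpr (one_ne_zero (α := k))
  exact ⟨ψ, AddChar.ne_one_iff.mpr ⟨1, hψ⟩⟩

/-- Irreducible representations of dimension `q` have a line of vectors fixed by the upper
unipotent group, and each nontrivial character of that group occurs once; all other
irreducible representations have dimension `1`, `q - 1` or `q + 1`. -/
theorem finrank_cases [FiniteDimensional ℂ V] (hρ : ρ.IsIrreducible) {ψ : AddChar k ℂ}
    (hψ : ψ ≠ 1) :
    Module.finrank ℂ V = 1 ∨ Module.finrank ℂ V = Fintype.card k - 1 ∨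
      Module.finrank ℂ V = Fintype.card k + 1 ∨
      (Module.finrank ℂ V = Fintype.card k ∧
        Module.finrank ℂ (LinearMap.range (proj ρ 1)) = 1 ∧
        Module.finrank ℂ (LinearMap.range (proj ρ ψ)) = 1) := by
  have := hρ.nontrivial
  have hpos : 0 < Module.finrank ℂ V := Module.finrank_pos
  have hq : 1 < Fintype.card k := Fintype.one_lt_card
  have hD := finrank_eq_add ρ ψ hψ
  have hm := finrank_range_proj_le_one ρ ψ hρ hψ
  by_cases h0 : LinearMap.range (proj ρ 1) = ⊥
  · rw [h0, finrank_bot] at hD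
    interval_cases h : Module.finrank ℂ (LinearMap.range (proj ρ ψ)) <;> omega
  obtain ⟨χ, v, hv⟩ := exists_isBorelEigenvector h0
  have ha := hv.finrank_range_proj_le_two hρ
  have ha0 : Module.finrank ℂ (LinearMap.range (proj ρ 1)) ≠ 0 := by
    rwa [Ne, Submodule.finrank_eq_zero]
  interval_cases h : Module.finrank ℂ (LinearMap.range (proj ρ ψ))
  · left
    refine hv.finrank_eq_one_of_trivial hρ fun x => LinearMap.ext fun v => ?_
    have htop : LinearMap.range (proj ρ 1) = ⊤ := Submodule.eq_top_of_finrank_eq (by omega)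
    exact (mem_range_proj_one ρ).mp (htop ▸ Submodule.mem_top) x
  · omega

end GL2

namespace GL2

open Matrix Representation

variable {k : Type*} [Field k] [Fintype k]

open Classical in
/-- The trace of the Steinberg representation, written as an average of a spherical function. -/
noncomputable def steinbergTrace (g : GL (Fin 2) k) : ℂ :=
  Fintype.card k / Fintype.card (GL (Fin 2) k) *
    ∑ h : GL (Fin 2) k, if (h * g * h⁻¹) 1 0 = 0 then 1 else -(Fintype.card k : ℂ)⁻¹

variable {V : Type*} [AddCommGroup V] [Module ℂ V]
  {ρ : Representation ℂ (GL (Fin 2) k) V}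

namespace IsBorelEigenvector

variable {χ : kˣ → kˣ → ℂ} {v : V} (hv : IsBorelEigenvector ρ χ v)

include hv

omit [Fintype k] in
theorem map_mul_mul (a d a' d' : kˣ) : χ (a * a') (d * d') = χ a d * χ a' d' := by
  refine smul_left_injective ℂ hv.ne_zero ?_
  simp only
  rw [← hv.dg_apply, ← dg_mul_dg, map_mul, Module.End.mul_apply, hv.dg_apply, map_smul,
    hv.dg_apply, smul_smul, mul_comm]

omit [Fintype k] in
theorem map_one_one : χ 1 1 = 1 := by
  refine smul_left_injective ℂ hv.ne_zero ?_
  have : dg (1 : kˣ) 1 = 1 := by apply ext <;> simp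
  simp only
  rw [← hv.dg_apply, this, map_one, one_smul, Module.End.one_apply]

omit [Fintype k] in
theorem exists_monoidHom (hsymm : ∀ a d, χ a d = χ d a) :
    ∃ μ : kˣ →* ℂˣ, ∀ a d, χ a d = μ (a * d) := by
  refine ⟨MonoidHom.toHomUnits
    { toFun := fun a => χ a 1
      map_one' := hv.map_one_one
      map_mul' := fun a b => by rw [← hv.map_mul_mul, one_mul] }, fun a d => ?_⟩
  change χ a d = χ (a * d) 1
  have h1 := hv.map_mul_mul a 1 1 d
  have h2 := hv.map_mul_mul a 1 d 1
  simp only [one_mul, mul_one] at h1 h2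
  rw [h1, h2, hsymm 1 d]

theorem trace_mul_proj [FiniteDimensional ℂ V]
    (h1 : Module.finrank ℂ (LinearMap.range (proj ρ 1)) = 1) {g : GL (Fin 2) k} {c : ℂ}
    (hc : proj ρ 1 (ρ g v) = c • v) : LinearMap.trace ℂ V (ρ g * proj ρ 1) = c := by
  have h : proj ρ 1 * ρ g * proj ρ 1 = c • proj ρ 1 := by
    ext x
    obtain ⟨t, ht⟩ := (finrank_eq_one_iff_of_nonzero'
      (⟨v, ⟨v, hv.proj_apply⟩⟩ : LinearMap.range _)
      (by simpa [Subtype.ext_iff] using hv.ne_zero)).mp h1 ⟨proj ρ 1 x, ⟨_, rfl⟩⟩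
    replace ht : t • v = proj ρ 1 x := congrArg Subtype.val ht
    simp only [Module.End.mul_apply, LinearMap.smul_apply]
    rw [← ht, map_smul, map_smul, hc, smul_comm]
  rw [← proj_mul_self, ← mul_assoc, LinearMap.trace_mul_comm, ← mul_assoc, h, map_smul,
    trace_proj, h1]
  simp

end IsBorelEigenvector

theorem exists_character_eq [FiniteDimensional ℂ V] (hρ : ρ.IsIrreducible)
    (hq : Module.finrank ℂ V = Fintype.card k) :
    ∃ μ : kˣ →* ℂˣ,
      (∀ g, ρ.character g = μ (GeneralLinearGroup.det g) * steinbergTrace g) ∧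
      ∀ a, (μ a : ℂ) = (Fintype.card k : ℂ)⁻¹ * ∑ x, ρ.character (dg a 1 * u x) := by
  classical
  obtain ⟨ψ, hψ⟩ := exists_addChar_ne_one k
  obtain ⟨h1, hm⟩ : Module.finrank ℂ (LinearMap.range (proj ρ 1)) = 1 ∧
      Module.finrank ℂ (LinearMap.range (proj ρ ψ)) = 1 := by
    have : 1 < Fintype.card k := Fintype.one_lt_card
    rcases finrank_cases hρ hψ with h | h | h | h
    · omega
    · omega
    · omega
    · exact h.2
  have hq0 : (Fintype.card k : ℂ) ≠ 0 := by simp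
  have hG0 : (Fintype.card (GL (Fin 2) k) : ℂ) ≠ 0 := by simp
  obtain ⟨χ, v, hv⟩ := exists_isBorelEigenvector (ρ := ρ) (fun h => by
    rw [h, finrank_bot] at h1
    exact zero_ne_one h1)
  obtain ⟨μ, hμ⟩ := hv.exists_monoidHom (hv.symm_of_finrank_eq_one h1)
  obtain ⟨c, hc⟩ := (finrank_eq_one_iff_of_nonzero' (⟨v, ⟨v, hv.proj_apply⟩⟩ : LinearMap.range _)
    (by simpa [Subtype.ext_iff] using hv.ne_zero)).mp h1 ⟨proj ρ 1 (ρ w v), ⟨_, rfl⟩⟩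
  replace hc : proj ρ 1 (ρ w v) = c • v := (congrArg Subtype.val hc).symm
  have hp0 {g : GL (Fin 2) k} (hg : g 1 0 = 0) :
      proj ρ 1 (ρ g v) = (μ (GeneralLinearGroup.det g) : ℂ) • v := by
    obtain ⟨a, d, had, h⟩ := hv.apply_of_eq_zero hg
    rw [h, map_smul, hv.proj_apply, hμ, had]
  have hp1 {g : GL (Fin 2) k} (hg : g 1 0 ≠ 0) :
      proj ρ 1 (ρ g v) = (μ (GeneralLinearGroup.det g) * c : ℂ) • v := by
    obtain ⟨a, d, had, h⟩ := hv.proj_apply_of_ne_zero hg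
    rw [h, hμ, had, hc, smul_smul]
  have htr (g : GL (Fin 2) k) : LinearMap.trace ℂ V (ρ g * proj ρ 1) =
      μ (GeneralLinearGroup.det g) * if g 1 0 = 0 then 1 else c := by
    split_ifs with hg
    · rw [mul_one]
      exact hv.trace_mul_proj h1 (hp0 hg)
    · exact hv.trace_mul_proj h1 (hp1 hg)
  have hchar (g : GL (Fin 2) k) : (Fintype.card (GL (Fin 2) k) : ℂ) * ρ.character g =
      Fintype.card k * (μ (GeneralLinearGroup.det g) *
        ∑ h : GL (Fin 2) k, if (h * g * h⁻¹) 1 0 = 0 then 1 else c) := by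
    have := hρ.card_mul_trace_mul_character (proj ρ 1) g
    rw [trace_proj, h1, Nat.cast_one, mul_one, hq] at this
    rw [this, Finset.mul_sum (a := (μ (GeneralLinearGroup.det g) : ℂ))]
    congr 1
    refine Finset.sum_congr rfl fun h _ => ?_
    rw [htr]
    congr 3
    simp
  have hc_eq : c = -(Fintype.card k : ℂ)⁻¹ := by
    have hquad := hv.proj_inv_w_proj_w
    have hlow : ∀ x ∈ Finset.univ.erase (0 : k),
        proj ρ 1 (ρ (mat 1 0 (-x) 1 (by simp)) v) = c • v := by
      intro x hx
      have hdet : GeneralLinearGroup.det (mat 1 0 (-x) 1 (by simp)) = 1 := by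
        ext; simp [det_fin_two]
      rw [hp1 (by simpa using hx), hdet, map_one, Units.val_one, one_mul]
    rw [Finset.sum_congr rfl hlow, hc, map_smul, map_smul, hp1 (by simp [inv_w]), map_inv, det_w,
      inv_one, map_one, Units.val_one, one_mul, Finset.sum_const,
      Finset.card_erase_of_mem (Finset.mem_univ _), Finset.card_univ] at hquad
    rw [← Nat.cast_smul_eq_nsmul ℂ, Nat.cast_sub Fintype.card_pos, smul_smul, smul_smul,
      smul_smul] at hquad
    nth_rewrite 2 [← one_smul ℂ v] at hquad
    rw [← add_smul] at hquad
    replace hquad := smul_left_injective ℂ hv.ne_zero hquad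
    have : (c - 1) * (Fintype.card k * c + 1) = 0 := by
      push_cast at hquad
      linear_combination hquad
    rcases mul_eq_zero.mp this with h | h
    · exfalso
      have hu := hchar (u 1)
      simp only [sub_eq_zero.mp h, ite_self, det_u, map_one, Units.val_one, one_mul,
        Finset.sum_const, Finset.card_univ, nsmul_eq_mul, mul_one] at hu
      have hu' : ρ.character (u 1) = Fintype.card k :=
        mul_left_cancel₀ hG0 (hu.trans (mul_comm _ _))
      have := card_mul_finrank_range_proj ρ ψ
      rw [hm, hu', hq, AddChar.sum_eq_zero_of_ne_one hψ] at this
      simp at this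
    · field_simp
      linear_combination h
  refine ⟨μ, fun g => ?_, fun a => ?_⟩
  · refine mul_left_cancel₀ hG0 ((hchar g).trans ?_)
    rw [steinbergTrace, hc_eq]
    field_simp
  · have := htr (dg a 1)
    rw [if_pos (by simp), det_dg, mul_one, mul_one] at this
    rw [← this, proj, mul_smul_comm, map_smul, smul_eq_mul, Finset.mul_sum, map_sum]
    simp only [AddChar.one_apply, one_smul, ← map_mul ρ]
    rfl

end GL2

namespace FDRep

open CategoryTheory

variable {G : Type} [Group G]

theorem isIrreducible_of_simple (V : FDRep ℂ G) [Simple V] :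
    Representation.IsIrreducible (V.ρ : Representation ℂ G V) := by
  have hnt : Nontrivial (Subrepresentation (V.ρ : Representation ℂ G V)) := by
    refine ⟨⊥, ⊤, fun h => id_nonzero V ?_⟩
    have h' : (⊥ : Submodule ℂ V) = ⊤ := congrArg Subrepresentation.toSubmodule h
    ext x
    exact (Submodule.mem_bot ℂ).mp (h' ▸ Submodule.mem_top : x ∈ (⊥ : Submodule ℂ V))
  refine ⟨fun W => ?_⟩
  by_cases hW : W.toSubmodule = ⊥
  · exact Or.inl (Subrepresentation.toSubmodule_injective hW)
  right
  let f : FDRep.of W.toRepresentation ⟶ V :=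
    ⟨FGModuleCat.ofHom W.toSubmodule.subtype, fun g => rfl⟩
  have hmono : Mono f := ConcreteCategory.mono_of_injective f W.toSubmodule.injective_subtype
  have hne : f ≠ 0 := by
    intro h
    obtain ⟨x, hx, hx0⟩ := W.toSubmodule.ne_bot_iff.mp hW
    have hzero : f.hom (⟨x, hx⟩ : W.toSubmodule) = 0 := by rw [h]; rfl
    exact hx0 hzero
  have := isIso_of_mono_of_nonzero hne
  refine Subrepresentation.toSubmodule_injective ?_
  refine (Submodule.eq_top_iff'.mpr fun x => ?_ : W.toSubmodule = ⊤)
  obtain ⟨y, rfl⟩ := (isoToLinearEquiv (asIso f)).surjective x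
  exact y.2

theorem simple_of_isIrreducible [Finite G] {V : Type} [AddCommGroup V] [Module ℂ V]
    [FiniteDimensional ℂ V] {ρ : Representation ℂ G V} (hρ : ρ.IsIrreducible) :
    Simple (FDRep.of ρ) := by
  have := Fintype.ofFinite G
  have hG : (Nat.card G : ℂ) ≠ 0 := by simp
  have := invertibleOfNonzero hG
  have h := Representation.char_orthonormal ρ ρ
  rw [if_pos ⟨Representation.Equiv.refl ρ⟩, inv_mul_eq_one₀ hG] at h
  exact (FDRep.simple_iff_char_is_norm_one _).mpr h.symm

/-- Twisting an irreducible representation by a linear character. -/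
theorem exists_simple_twist [Finite G] (V : FDRep ℂ G) [Simple V] (μ : G →* ℂˣ) :
    ∃ W : FDRep ℂ G, Simple W ∧ Module.finrank ℂ W = Module.finrank ℂ V ∧
      ∀ g, W.character g = μ g * V.character g := by
  have := Fintype.ofFinite G
  let τ : Representation ℂ G V :=
    { toFun := fun g => (μ g : ℂ) • V.ρ g
      map_one' := by simp
      map_mul' := fun g h => by
        rw [map_mul, map_mul, smul_mul_smul_comm, Units.val_mul] }
  have hτ (g : G) : (FDRep.of τ).character g = μ g * V.character g :=
    map_smul (LinearMap.trace ℂ V) (μ g : ℂ) (V.ρ g)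
  refine ⟨FDRep.of τ, ?_, rfl, hτ⟩
  rw [FDRep.simple_iff_char_is_norm_one, ← (FDRep.simple_iff_char_is_norm_one V).mp inferInstance]
  refine Finset.sum_congr rfl fun g _ => ?_
  rw [hτ, hτ, mul_mul_mul_comm, ← Units.val_mul, ← map_mul, mul_inv_cancel]
  simp

theorem linearIndependent_character [Finite G] {ι : Type*} (V : ι → FDRep ℂ G)
    [∀ i, Simple (V i)] (hV : Function.Injective fun i => (V i).character) :
    LinearIndependent ℂ fun i => (V i).character := by
  classical
  have := Fintype.ofFinite G
  have hG : (Nat.card G : ℂ) ≠ 0 := by simp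
  have := invertibleOfNonzero hG
  rw [linearIndependent_iff']
  intro s c hc i hi
  have h1 : (Nat.card G : ℂ)⁻¹ * ∑ g : G, (∑ j ∈ s, c j • (V j).character) g *
      (V i).character g⁻¹ = c i := by
    simp only [Finset.sum_apply, Pi.smul_apply, smul_eq_mul, Finset.sum_mul]
    rw [Finset.sum_comm, Finset.mul_sum, Finset.sum_eq_single i]
    · simp only [mul_assoc]
      rw [← Finset.mul_sum, mul_left_comm, char_orthonormal, if_pos ⟨Iso.refl _⟩, mul_one]
    · intro j _ hj
      simp only [mul_assoc]
      rw [← Finset.mul_sum, mul_left_comm, char_orthonormal, if_neg, mul_zero]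
      rintro ⟨f⟩
      exact hj (hV (char_iso f))
    · exact fun h => absurd hi h
  rw [← h1, hc]
  simp


end FDRep

theorem finite_irrCharDegSet (G : Type) [Group G] [Finite G] : (irrCharDegSet G).Finite := by
  have hinj : Set.InjOn Prod.fst (irrCharDegSet G) := by
    rintro ⟨χ, d⟩ ⟨V, -, h1, h2⟩ ⟨χ', d'⟩ ⟨V', -, h1', h2'⟩ h
    simp only at h1 h2 h1' h2' h
    have := congrFun h 1
    rw [h1, h1', FDRep.char_one, FDRep.char_one, ← h2, ← h2', Nat.cast_inj] at this
    rw [h, this]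
  refine Set.Finite.of_finite_image ?_ hinj
  have hmem (χ : Prod.fst '' irrCharDegSet G) :
      ∃ V : FDRep ℂ G, CategoryTheory.Simple V ∧ V.character = χ := by
    obtain ⟨-, p, ⟨V, hV, h1, -⟩, rfl⟩ := χ
    exact ⟨V, hV, h1.symm⟩
  choose V hV hχ using hmem
  have := FDRep.linearIndependent_character V fun a b h => Subtype.ext (by
    rw [← hχ, ← hχ]; exact h)
  have := this.finite
  exact Set.toFinite _

theorem padicValRat_finset_prod {p : ℕ} [Fact p.Prime] {ι : Type*} (s : Finset ι) (f : ι → ℚ)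
    (hf : ∀ i ∈ s, f i ≠ 0) : padicValRat p (∏ i ∈ s, f i) = ∑ i ∈ s, padicValRat p (f i) := by
  classical
  induction s using Finset.induction_on with
  | empty => simp
  | insert a s ha ih =>
    rw [Finset.prod_insert ha, Finset.sum_insert ha, padicValRat.mul (hf a (by simp))
      (Finset.prod_ne_zero_iff.mpr fun i hi => hf i (by simp [hi])),
      ih fun i hi => hf i (by simp [hi])]

namespace GL2

open Matrix Representation
open scoped OnePoint

variable {k : Type*} [Field k]

instance [DecidableEq k] : DecidableEq (OnePoint k) := inferInstanceAs (DecidableEq (Option k))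

theorem exists_smul_infty_eq [DecidableEq k] (x : OnePoint k) :
    ∃ g : GL (Fin 2) k, g • (∞ : OnePoint k) = x := by
  induction x using OnePoint.rec with
  | infty => exact ⟨1, one_smul _ _⟩
  | coe x =>
    refine ⟨mat x (-1) 1 0 (by simp), ?_⟩
    rw [OnePoint.smul_infty_eq_ite]
    simp

theorem u_smul_infty [DecidableEq k] (x : k) : u x • (∞ : OnePoint k) = ∞ := by
  rw [OnePoint.smul_infty_eq_self_iff]
  simp

theorem u_smul_coe [DecidableEq k] (x y : k) :
    u x • (y : OnePoint k) = ((y + x : k) : OnePoint k) := by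
  rw [OnePoint.smul_some_eq_ite]
  simp

/-- The permutation representation on functions on the projective line. -/
noncomputable def permRep (k : Type*) [Field k] [DecidableEq k] :
    Representation ℂ (GL (Fin 2) k) (OnePoint k → ℂ) where
  toFun g := LinearMap.funLeft ℂ ℂ fun x => g⁻¹ • x
  map_one' := by ext; simp
  map_mul' g h := by
    ext f x
    simp [LinearMap.funLeft_apply, mul_smul]

variable [DecidableEq k]

theorem permRep_apply (g : GL (Fin 2) k) (f : OnePoint k → ℂ) (x : OnePoint k) :
    permRep k g f x = f (g⁻¹ • x) := rfl

variable [Fintype k]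

theorem sum_permRep_apply (g : GL (Fin 2) k) (f : OnePoint k → ℂ) :
    ∑ x, permRep k g f x = ∑ x, f x :=
  Fintype.sum_equiv (MulAction.toPerm g⁻¹) _ _ fun _ => rfl

omit [Field k] [DecidableEq k] in
theorem sum_onePoint (f : OnePoint k → ℂ) : ∑ x, f x = f ∞ + ∑ x : k, f x :=
  Fintype.sum_option f

theorem sum_permRep_u (f : OnePoint k → ℂ) (hf : ∑ x, f x = 0) :
    ∑ x, permRep k (u x) f = f ∞ • ((Fintype.card k + 1 : ℂ) • Pi.single ∞ 1 - 1) := by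
  have hinv (x : k) : (u x)⁻¹ = u (-x) := by
    rw [inv_eq_iff_mul_eq_one, u_mul_u, add_neg_cancel, u_zero]
  rw [sum_onePoint] at hf
  ext y
  simp only [Finset.sum_apply, permRep_apply, hinv]
  induction y using OnePoint.rec with
  | infty => simp [u_smul_infty, mul_comm]
  | coe y =>
    have h : ∑ x : k, f (u (-x) • (y : OnePoint k)) = ∑ x : k, f x :=
      Fintype.sum_equiv (Equiv.subLeft y) _ _ fun x => by simp [u_smul_coe, sub_eq_add_neg]
    rw [h]
    simp
    linear_combination hf

theorem mem_of_sum_eq_zero (S : Submodule ℂ (OnePoint k → ℂ))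
    (hS : ∀ g, ∀ f ∈ S, permRep k g f ∈ S) (hsum : ∀ f ∈ S, ∑ x, f x = 0) (h0 : S ≠ ⊥)
    (f : OnePoint k → ℂ) (hf : ∑ x, f x = 0) : f ∈ S := by
  obtain ⟨f₀, hf₀, hne⟩ := S.ne_bot_iff.mp h0
  obtain ⟨x, hx⟩ := Function.ne_iff.mp hne
  obtain ⟨g, rfl⟩ := exists_smul_infty_eq x
  have hb : (Fintype.card k + 1 : ℂ) • Pi.single ∞ 1 - 1 ∈ S := by
    refine (S.smul_mem_iff (s := permRep k g⁻¹ f₀ ∞) ?_).mp ?_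
    · rwa [permRep_apply, inv_inv]
    · rw [← sum_permRep_u _ (by rw [sum_permRep_apply, hsum f₀ hf₀])]
      exact S.sum_mem fun y _ => hS _ _ (hS _ _ hf₀)
  have hb' (x : OnePoint k) : (Fintype.card k + 1 : ℂ) • Pi.single x 1 - 1 ∈ S := by
    obtain ⟨g, rfl⟩ := exists_smul_infty_eq x
    convert hS g _ hb using 1
    ext y
    simp [permRep_apply, Pi.single_apply, inv_smul_eq_iff]
  have key : (Fintype.card k + 1 : ℂ) • f =
      ∑ x, f x • ((Fintype.card k + 1 : ℂ) • Pi.single x 1 - 1) := by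
    ext y
    simp only [Finset.sum_apply, Pi.smul_apply, Pi.sub_apply, smul_eq_mul, Pi.one_apply, mul_sub,
      mul_one, Finset.sum_sub_distrib, hf, Pi.single_apply]
    simp [mul_comm]
  refine (S.smul_mem_iff (s := (Fintype.card k + 1 : ℂ)) (by norm_cast)).mp ?_
  rw [key]
  exact S.sum_mem fun x _ => S.smul_mem _ (hb' x)

/-- The Steinberg representation: functions on the projective line with sum zero. -/
noncomputable def steinbergSub (k : Type*) [Field k] [DecidableEq k] [Fintype k] :
    Subrepresentation (permRep k) where
  toSubmodule := LinearMap.ker (∑ x : OnePoint k, LinearMap.proj x : (OnePoint k → ℂ) →ₗ[ℂ] ℂ)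
  apply_mem_toSubmodule g f hf := by
    simp only [LinearMap.mem_ker, LinearMap.sum_apply, LinearMap.proj_apply] at hf ⊢
    rw [sum_permRep_apply, hf]

theorem mem_steinbergSub {f : OnePoint k → ℂ} :
    f ∈ (steinbergSub k).toSubmodule ↔ ∑ x, f x = 0 := by
  simp [steinbergSub]

theorem finrank_steinbergSub :
    Module.finrank ℂ (steinbergSub k).toSubmodule = Fintype.card k := by
  have h := Module.Dual.finrank_ker_add_one_of_ne_zero
    (f := (∑ x : OnePoint k, LinearMap.proj x : (OnePoint k → ℂ) →ₗ[ℂ] ℂ)) (fun h => by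
      have := LinearMap.congr_fun h (Pi.single ∞ 1)
      simp [LinearMap.sum_apply, Pi.single_apply] at this)
  have hc : Fintype.card (OnePoint k) = Fintype.card k + 1 := Fintype.card_option
  rw [Module.finrank_fintype_fun_eq_card, hc] at h
  exact Nat.succ_injective h

theorem isIrreducible_steinbergSub : (steinbergSub k).toRepresentation.IsIrreducible := by
  have hnt : Nontrivial (Subrepresentation (steinbergSub k).toRepresentation) := by
    refine ⟨⊥, ⊤, fun h => ?_⟩
    have h' : (⊥ : Submodule ℂ (steinbergSub k).toSubmodule) = ⊤ :=
      congrArg Subrepresentation.toSubmodule h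
    have := finrank_steinbergSub (k := k)
    rw [← finrank_top, ← h', finrank_bot] at this
    exact Fintype.card_ne_zero this.symm
  refine ⟨fun T => ?_⟩
  by_cases hT : T.toSubmodule = ⊥
  · exact Or.inl (Subrepresentation.toSubmodule_injective hT)
  right
  refine Subrepresentation.toSubmodule_injective ?_
  refine (Submodule.eq_top_iff'.mpr fun f => ?_ : T.toSubmodule = ⊤)
  have hmem := mem_of_sum_eq_zero (T.toSubmodule.map (steinbergSub k).toSubmodule.subtype)
    (by
      rintro g _ ⟨f, hf, rfl⟩
      exact ⟨_, T.apply_mem_toSubmodule g hf, rfl⟩)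
    (by
      rintro _ ⟨f, -, rfl⟩
      exact mem_steinbergSub.mp f.2)
    (fun h => hT (Submodule.map_injective_of_injective (Submodule.injective_subtype _)
      (h.trans (Submodule.map_bot _).symm)))
    f (mem_steinbergSub.mp f.2)
  obtain ⟨f', hf', h⟩ := hmem
  rwa [← Subtype.ext h]

end GL2

namespace GL2

open Matrix Representation

variable {k : Type} [Field k] [Fintype k]

theorem exists_simple_character_eq (μ : kˣ →* ℂˣ) :
    ∃ V : FDRep ℂ (GL (Fin 2) k), CategoryTheory.Simple V ∧
      Module.finrank ℂ V = Fintype.card k ∧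
      V.character = fun g => μ (GeneralLinearGroup.det g) * steinbergTrace g := by
  classical
  have hirr := isIrreducible_steinbergSub (k := k)
  have := FDRep.simple_of_isIrreducible hirr
  obtain ⟨μ₀, hμ₀, -⟩ := exists_character_eq hirr finrank_steinbergSub
  obtain ⟨V, hV, hdim, hchar⟩ := FDRep.exists_simple_twist
    (FDRep.of (steinbergSub k).toRepresentation) ((μ * μ₀⁻¹).comp GeneralLinearGroup.det)
  refine ⟨V, hV, hdim.trans finrank_steinbergSub, funext fun g => ?_⟩
  rw [hchar]
  change _ * (steinbergSub k).toRepresentation.character g = _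
  rw [hμ₀]
  simp [mul_assoc]

theorem sum_steinbergTrace (a : kˣ) :
    (Fintype.card k : ℂ)⁻¹ * ∑ x : k, steinbergTrace (dg a 1 * u x) = 1 := by
  classical
  obtain ⟨μ, hμ, hμ'⟩ :=
    exists_character_eq (isIrreducible_steinbergSub (k := k)) finrank_steinbergSub
  refine mul_left_cancel₀ (μ a).ne_zero ?_
  conv_rhs => rw [mul_one, hμ' a]
  simp only [hμ, map_mul, det_dg, det_u, mul_one]
  rw [← Finset.mul_sum, mul_left_comm]

theorem det_mul_steinbergTrace_injective : Function.Injective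
    fun (μ : kˣ →* ℂˣ) (g : GL (Fin 2) k) =>
      (μ (GeneralLinearGroup.det g) : ℂ) * steinbergTrace g := by
  intro μ ν h
  ext a
  have hsum := congrArg (fun f : GL (Fin 2) k → ℂ =>
    (Fintype.card k : ℂ)⁻¹ * ∑ x : k, f (dg a 1 * u x)) h
  simp only [map_mul, det_dg, det_u, mul_one] at hsum
  simpa only [← Finset.mul_sum, mul_left_comm _ (Units.val _), sum_steinbergTrace, mul_one]
    using hsum

theorem ncard_degree_eq_card :
    {p ∈ irrCharDegSet (GL (Fin 2) k) | p.2 = Fintype.card k}.ncard = Fintype.card k - 1 := by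
  have hset : {p ∈ irrCharDegSet (GL (Fin 2) k) | p.2 = Fintype.card k} =
      Set.range fun μ : kˣ →* ℂˣ => ((fun g : GL (Fin 2) k =>
        (μ (GeneralLinearGroup.det g) : ℂ) * steinbergTrace g), Fintype.card k) := by
    ext ⟨χ, d⟩
    constructor
    · rintro ⟨⟨V, hV, h1, h2⟩, h3⟩
      simp only at h1 h2 h3
      have := FDRep.isIrreducible_of_simple V
      obtain ⟨μ, hμ, -⟩ := exists_character_eq this (h2.symm.trans h3)
      exact ⟨μ, Prod.ext (h1.trans (funext hμ)).symm h3.symm⟩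
    · rintro ⟨μ, h⟩
      obtain ⟨V, hV, h1, h2⟩ := exists_simple_character_eq μ
      rw [← h]
      exact ⟨⟨V, hV, h2.symm, h1.symm⟩, rfl⟩
  rw [hset, ← Set.image_univ, Set.ncard_image_of_injective _ fun μ ν h =>
    det_mul_steinbergTrace_injective (congrArg Prod.fst h), Set.ncard_univ,
    CommGroup.card_monoidHom_of_hasEnoughRootsOfUnity, Nat.card_units, Nat.card_eq_fintype_card]

theorem degree_cases {p : (GL (Fin 2) k → ℂ) × ℕ} (hp : p ∈ irrCharDegSet (GL (Fin 2) k)) :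
    p.2 = 1 ∨ p.2 = Fintype.card k - 1 ∨ p.2 = Fintype.card k + 1 ∨ p.2 = Fintype.card k := by
  obtain ⟨V, hV, -, h⟩ := hp
  obtain ⟨ψ, hψ⟩ := exists_addChar_ne_one k
  rw [h]
  rcases finrank_cases (FDRep.isIrreducible_of_simple V) hψ with h | h | h | h
  exacts [.inl h, .inr (.inl h), .inr (.inr (.inl h)), .inr (.inr (.inr h.1))]

theorem padicValRat_finprod_degree {p e : ℕ} (hp : p.Prime) (he : 0 < e)
    (hk : Fintype.card k = p ^ e) :
    (∏ᶠ x ∈ irrCharDegSet (GL (Fin 2) k), (x.2 : ℚ)) ≠ 0 ∧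
      padicValRat p (∏ᶠ x ∈ irrCharDegSet (GL (Fin 2) k), (x.2 : ℚ)) = e * (p ^ e - 1 : ℤ) := by
  classical
  have := Fact.mk hp
  have hfin := finite_irrCharDegSet (GL (Fin 2) k)
  have hq : 1 < Fintype.card k := Fintype.one_lt_card
  have hdvd : p ∣ Fintype.card k := hk ▸ dvd_pow_self p he.ne'
  have hne : ∀ x ∈ hfin.toFinset, (x.2 : ℚ) ≠ 0 := by
    intro x hx
    have := degree_cases (hfin.mem_toFinset.mp hx)
    rw [Nat.cast_ne_zero]
    omega
  have hval : ∀ x ∈ hfin.toFinset,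
      padicValRat p (x.2 : ℚ) = if x.2 = Fintype.card k then (e : ℤ) else 0 := by
    intro x hx
    have hx' := degree_cases (hfin.mem_toFinset.mp hx)
    split_ifs with h
    · rw [h, hk]
      simp
    · rw [padicValRat.of_nat, Nat.cast_eq_zero]
      refine padicValNat.eq_zero_of_not_dvd fun hd => hp.one_lt.ne' (Nat.dvd_one.mp ?_)
      rcases hx' with h' | h' | h' | h'
      · rwa [h'] at hd
      · rw [h'] at hd
        exact (Nat.dvd_add_right hd).mp
          ((Nat.sub_add_cancel hq.le).symm ▸ hdvd)
      · rw [h'] at hd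
        exact (Nat.dvd_add_right hdvd).mp hd
      · exact absurd h' h
  rw [finprod_mem_eq_finite_toFinset_prod _ hfin]
  refine ⟨Finset.prod_ne_zero_iff.mpr hne, ?_⟩
  rw [padicValRat_finset_prod _ _ hne, Finset.sum_congr rfl hval, ← Finset.sum_filter,
    Finset.sum_const, nsmul_eq_mul, mul_comm]
  have hcard := ncard_degree_eq_card (k := k)
  rw [Set.ncard_eq_toFinset_card _ (hfin.subset (Set.sep_subset _ _))] at hcard
  have : {x ∈ hfin.toFinset | x.2 = Fintype.card k} =
      (hfin.subset (Set.sep_subset _ fun x => x.2 = Fintype.card k)).toFinset := by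
    ext
    simp
  rw [this, hcard, Nat.cast_sub hq.le, hk]
  push_cast
  rfl

end GL2

namespace GL2

open Matrix

variable {k : Type*} [Field k]

/-- Trace and determinant of an invertible matrix. -/
def traceDet (g : GL (Fin 2) k) : k × kˣ :=
  ((g : Matrix (Fin 2) (Fin 2) k).trace, GeneralLinearGroup.det g)

/-- Trace and determinant of a scalar matrix. -/
def scalarTraceDet (a : kˣ) : k × kˣ := (2 * a, a ^ 2)

theorem traceDet_eq_iff {g : GL (Fin 2) k} {x : k × kˣ} :
    traceDet g = x ↔ g 0 0 + g 1 1 = x.1 ∧ g 0 0 * g 1 1 - g 0 1 * g 1 0 = x.2 := by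
  rw [traceDet, Prod.ext_iff, trace_fin_two, Units.ext_iff]
  simp [det_fin_two]

theorem traceDet_eq_of_isConj {g h : GL (Fin 2) k} (hgh : IsConj g h) :
    traceDet g = traceDet h := by
  obtain ⟨c, rfl⟩ := isConj_iff.mp hgh
  ext1
  · simp [traceDet, trace_mul_cycle]
  · simp [traceDet]

theorem scalarTraceDet_injective : Function.Injective (scalarTraceDet (k := k)) := by
  intro a b h
  simp only [scalarTraceDet, Prod.mk.injEq, Units.ext_iff, Units.val_pow_eq_pow_val] at h
  have : ((a : k) - b) ^ 2 = 0 := by linear_combination h.2 - (b : k) * h.1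
  exact Units.ext (sub_eq_zero.mp (pow_eq_zero_iff two_ne_zero |>.mp this))

theorem traceDet_dg (a : kˣ) : traceDet (dg a a) = scalarTraceDet a := by
  rw [traceDet_eq_iff]
  simp [scalarTraceDet]
  constructor <;> ring

theorem dg_mul_comm (a : kˣ) (g : GL (Fin 2) k) : g * dg a a = dg a a * g := by
  apply ext <;> simp [Matrix.mul_apply, Fin.sum_univ_two, mul_comm]

/-- The companion matrix with given trace and determinant. -/
noncomputable def companion (x : k × kˣ) : GL (Fin 2) k := mat 0 (-x.2) 1 x.1 (by simp)

theorem traceDet_companion (x : k × kˣ) : traceDet (companion x) = x := by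
  rw [traceDet_eq_iff]
  simp [companion]

theorem isConj_companion_of_ne_zero (g : GL (Fin 2) k) (x y : k)
    (h : x * (g 1 0 * x + g 1 1 * y) - (g 0 0 * x + g 0 1 * y) * y ≠ 0) :
    IsConj (companion (traceDet g)) g := by
  rw [isConj_iff]
  refine ⟨mat x (g 0 0 * x + g 0 1 * y) y (g 1 0 * x + g 1 1 * y) h, ?_⟩
  rw [mul_inv_eq_iff_eq_mul]
  apply ext <;> simp [Matrix.mul_apply, Fin.sum_univ_two, companion, traceDet, trace_fin_two,
    det_fin_two] <;> ring

theorem isConj_companion {g : GL (Fin 2) k} (hg : ∀ a, g ≠ dg a a) :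
    IsConj (companion (traceDet g)) g := by
  by_cases h10 : g 1 0 = 0
  · by_cases h01 : g 0 1 = 0
    · refine isConj_companion_of_ne_zero g 1 1 fun h => ?_
      have h0 := det_ne_zero g
      simp only [h01, zero_mul, sub_zero] at h0
      refine hg (Units.mk0 _ (left_ne_zero_of_mul h0)) ?_
      simp [h10, h01, sub_eq_zero] at h
      apply ext <;> simp [h10, h01, h]
    · exact isConj_companion_of_ne_zero g 0 1 (by simpa using h01)
  · exact isConj_companion_of_ne_zero g 1 0 (by simpa using h10)

theorem isConj_iff_traceDet_eq {g h : GL (Fin 2) k} (hg : ∀ a, g ≠ dg a a)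
    (hh : ∀ a, h ≠ dg a a) : IsConj g h ↔ traceDet g = traceDet h :=
  ⟨traceDet_eq_of_isConj, fun he =>
    (isConj_companion hg).symm.trans (he ▸ isConj_companion hh)⟩

theorem ne_dg_of_notMem {g : GL (Fin 2) k} (hg : traceDet g ∉ Set.range scalarTraceDet)
    (a : kˣ) : g ≠ dg a a := by
  rintro rfl
  exact hg ⟨a, (traceDet_dg a).symm⟩

theorem carrier_eq_of_notMem {g : GL (Fin 2) k} (hg : traceDet g ∉ Set.range scalarTraceDet) :
    (ConjClasses.mk g).carrier = {h | traceDet h = traceDet g} := by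
  ext h
  rw [ConjClasses.mem_carrier_iff_mk_eq, ConjClasses.mk_eq_mk_iff_isConj]
  refine ⟨traceDet_eq_of_isConj, fun he => ?_⟩
  exact (isConj_iff_traceDet_eq (ne_dg_of_notMem (he ▸ hg)) (ne_dg_of_notMem hg)).mpr he

theorem isConj_dg {h : GL (Fin 2) k} {a : kˣ} : IsConj h (dg a a) ↔ h = dg a a := by
  refine ⟨fun hc => ?_, fun hc => hc ▸ IsConj.refl _⟩
  obtain ⟨c, hc⟩ := isConj_iff.mp hc.symm
  rw [← hc, dg_mul_comm, mul_inv_cancel_right]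

theorem carrier_mk_dg (a : kˣ) : (ConjClasses.mk (dg a a)).carrier = {dg a a} := by
  ext h
  rw [ConjClasses.mem_carrier_iff_mk_eq, ConjClasses.mk_eq_mk_iff_isConj, isConj_dg]
  rfl

theorem carrier_eq_of_eq_scalarTraceDet {g : GL (Fin 2) k} {a : kˣ}
    (hg : traceDet g = scalarTraceDet a) (hga : g ≠ dg a a) :
    (ConjClasses.mk g).carrier = {h | traceDet h = traceDet g} \ {dg a a} := by
  have hne {h : GL (Fin 2) k} (hh : traceDet h = traceDet g) (hha : h ≠ dg a a) (b : kˣ) :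
      h ≠ dg b b := by
    rintro rfl
    rw [traceDet_dg, hg] at hh
    exact hha (by rw [scalarTraceDet_injective hh])
  ext h
  rw [ConjClasses.mem_carrier_iff_mk_eq, ConjClasses.mk_eq_mk_iff_isConj]
  refine ⟨fun hc => ⟨traceDet_eq_of_isConj hc, ?_⟩, fun hc => ?_⟩
  · rintro rfl
    exact hga (isConj_dg.mp hc.symm)
  · exact (isConj_iff_traceDet_eq (hne hc.1 hc.2) (hne rfl hga)).mpr hc.1

variable [Fintype k]

theorem card_mul_eq [DecidableEq k] (s : k) :
    (∑ b : k, ∑ c : k, if b * c = s then 1 else 0) =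
      (Fintype.card k - 1) + if s = 0 then Fintype.card k else 0 := by
  rw [← Finset.sum_erase_add _ _ (Finset.mem_univ (0 : k))]
  congr 1
  · rw [Finset.sum_congr (g := fun _ => 1) rfl fun b hb => ?_]
    · simp [Finset.card_erase_of_mem]
    · have hb0 := Finset.ne_of_mem_erase hb
      have h (c : k) : b * c = s ↔ c = s / b := by rw [eq_div_iff hb0, mul_comm]
      simp [h]
  · simp [eq_comm]

theorem ncard_traceDet_eq [DecidableEq k] (x : k × kˣ) :
    {g : GL (Fin 2) k | traceDet g = x}.ncard =
      Fintype.card k * ((Fintype.card k - 1) +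
        Finset.card {a : k | a * (x.1 - a) - x.2 = 0}) := by
  let F : GL (Fin 2) k → k × k × k := fun g => (g 0 0, g 0 1, g 1 0)
  have hF : Set.InjOn F {g | traceDet g = x} := by
    intro g hg h hh hgh
    simp only [F, Prod.mk.injEq] at hgh
    have h1 := (traceDet_eq_iff.mp hg).1
    have h2 := (traceDet_eq_iff.mp hh).1
    refine ext hgh.1 hgh.2.1 hgh.2.2 ?_
    linear_combination h1 - h2 - hgh.1
  have himage : F '' {g | traceDet g = x} =
      ({y : k × k × k | y.2.1 * y.2.2 = y.1 * (x.1 - y.1) - x.2} : Finset _) := by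
    ext ⟨a, b, c⟩
    simp only [Set.mem_image, Finset.coe_filter, Finset.mem_univ, true_and, Set.mem_ofPred_eq]
    constructor
    · rintro ⟨g, hg, h⟩
      simp only [F, Prod.mk.injEq] at h
      obtain ⟨rfl, rfl, rfl⟩ := h
      obtain ⟨h1, h2⟩ := traceDet_eq_iff.mp hg
      linear_combination g 0 0 * h1 - h2
    · intro h
      have hdet : a * (x.1 - a) - b * c = x.2 := by linear_combination -h
      refine ⟨mat a b c (x.1 - a) (hdet ▸ x.2.ne_zero), traceDet_eq_iff.mpr ?_, rfl⟩
      simpa using hdet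
  rw [← hF.ncard_image, himage, Set.ncard_coe_finset, Finset.card_filter, Fintype.sum_prod_type]
  simp only [Fintype.sum_prod_type, card_mul_eq]
  rw [Finset.sum_add_distrib, Finset.sum_const, Finset.card_univ, ← Finset.sum_filter,
    Finset.sum_const, smul_eq_mul, smul_eq_mul, mul_add, mul_comm (Fintype.card k) (Finset.card _)]

theorem card_roots_scalarTraceDet [DecidableEq k] (a : kˣ) :
    Finset.card {b : k | b * ((scalarTraceDet a).1 - b) - (scalarTraceDet a).2 = 0} = 1 := by
  rw [Finset.card_eq_one]
  refine ⟨(a : k), ?_⟩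
  ext b
  have h : b * ((scalarTraceDet a).1 - b) - (scalarTraceDet a).2 = -(b - a) ^ 2 := by
    simp only [scalarTraceDet, Units.val_pow_eq_pow_val]
    ring
  rw [Finset.mem_filter_univ, Finset.mem_singleton, h, neg_eq_zero, pow_eq_zero_iff two_ne_zero,
    sub_eq_zero]

theorem card_roots_of_notMem [DecidableEq k] {x : k × kˣ} (hx : x ∉ Set.range scalarTraceDet) :
    Finset.card {b : k | b * (x.1 - b) - x.2 = 0} = 0 ∨
      Finset.card {b : k | b * (x.1 - b) - x.2 = 0} = 2 := by
  by_cases h : ∃ a, a * (x.1 - a) - x.2 = 0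
  · right
    obtain ⟨a, ha⟩ := h
    have ha0 : a ≠ 0 := by
      rintro rfl
      simp at ha
    have hne : a ≠ x.1 - a := by
      intro h
      refine hx ⟨Units.mk0 a ha0, Prod.ext ?_ (Units.ext ?_)⟩
      · simp only [scalarTraceDet, Units.val_mk0]
        linear_combination h
      · simp only [scalarTraceDet, Units.val_mk0, Units.val_pow_eq_pow_val]
        linear_combination ha + a * h
    rw [Finset.card_eq_two]
    refine ⟨a, x.1 - a, hne, ?_⟩
    ext b
    simp only [Finset.mem_filter, Finset.mem_univ, true_and, Finset.mem_insert,
      Finset.mem_singleton]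
    rw [← sub_eq_zero (a := b), ← sub_eq_zero (a := b) (b := x.1 - a), ← mul_eq_zero]
    constructor <;> intro h
    · linear_combination ha - h
    · linear_combination ha - h
  · left
    rw [Finset.card_eq_zero, Finset.filter_eq_empty_iff]
    exact fun a _ ha => h ⟨a, ha⟩

end GL2

namespace GL2

open Matrix

variable {k : Type*} [Field k] [Fintype k]

/-- Trace and determinant of a conjugacy class. -/
def classTraceDet : ConjClasses (GL (Fin 2) k) → k × kˣ :=
  Quotient.lift GL2.traceDet fun _ _ => traceDet_eq_of_isConj

omit [Fintype k] in
theorem classTraceDet_mk (g : GL (Fin 2) k) :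
    classTraceDet (ConjClasses.mk g) = GL2.traceDet g := rfl

theorem ncard_traceDet_notMem :
    {c : ConjClasses (GL (Fin 2) k) |
      classTraceDet c ∉ Set.range scalarTraceDet}.ncard = (Fintype.card k - 1) ^ 2 := by
  have hinj : Set.InjOn classTraceDet {c : ConjClasses (GL (Fin 2) k) |
      classTraceDet c ∉ Set.range scalarTraceDet} := by
    intro c hc d hd hcd
    obtain ⟨g, rfl⟩ := ConjClasses.exists_rep c
    obtain ⟨h, rfl⟩ := ConjClasses.exists_rep d
    exact ConjClasses.mk_eq_mk_iff_isConj.mpr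
      ((isConj_iff_traceDet_eq (ne_dg_of_notMem hc) (ne_dg_of_notMem hd)).mpr hcd)
  have himage : classTraceDet '' {c : ConjClasses (GL (Fin 2) k) |
      classTraceDet c ∉ Set.range scalarTraceDet} = (Set.range scalarTraceDet)ᶜ := by
    ext x
    constructor
    · rintro ⟨c, hc, rfl⟩
      exact hc
    · intro hx
      have h : classTraceDet (ConjClasses.mk (companion x)) = x := traceDet_companion x
      refine ⟨ConjClasses.mk (companion x), ?_, h⟩
      rwa [Set.mem_ofPred_eq, h]
  rw [← hinj.ncard_image, himage, Set.ncard_compl, ← Set.image_univ,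
    Set.ncard_image_of_injective _ scalarTraceDet_injective, Set.ncard_univ, Nat.card_prod,
    Nat.card_units, Nat.card_eq_fintype_card, ← Nat.sub_one_mul, sq]

theorem padicValNat_ncard_carrier [DecidableEq k] {p e : ℕ} (hp : p.Prime) (he : 0 < e)
    (hk : Fintype.card k = p ^ e) (c : ConjClasses (GL (Fin 2) k)) :
    c.carrier.ncard ≠ 0 ∧ padicValNat p c.carrier.ncard =
      if classTraceDet c ∈ Set.range scalarTraceDet then 0 else e := by
  have := Fact.mk hp
  have hq : 1 < Fintype.card k := Fintype.one_lt_card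
  have hdvd : p ∣ Fintype.card k := hk ▸ dvd_pow_self p he.ne'
  have hndvd : ¬ p ∣ Fintype.card k - 1 := fun hd => hp.one_lt.ne' (Nat.dvd_one.mp
    ((Nat.dvd_add_right hd).mp ((Nat.sub_add_cancel hq.le).symm ▸ hdvd)))
  refine ⟨?_, ?_⟩
  · obtain ⟨g, rfl⟩ := ConjClasses.exists_rep c
    exact Set.ncard_ne_zero_of_mem ConjClasses.mem_carrier_mk
  obtain ⟨g, rfl⟩ := ConjClasses.exists_rep c
  rw [classTraceDet_mk]
  split_ifs with hg
  · refine padicValNat.eq_zero_of_not_dvd ?_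
    obtain ⟨a, ha⟩ := hg
    by_cases hga : g = dg a a
    · rw [hga, carrier_mk_dg, Set.ncard_singleton]
      exact hp.one_lt.ne' ∘ Nat.dvd_one.mp
    · rw [carrier_eq_of_eq_scalarTraceDet ha.symm hga, Set.ncard_sdiff_singleton_of_mem
        (by rw [← ha]; exact traceDet_dg a), ncard_traceDet_eq, ← ha, card_roots_scalarTraceDet,
        Nat.sub_add_cancel hq.le]
      have hpos : 1 ≤ Fintype.card k * Fintype.card k := Nat.mul_pos (by omega) (by omega)
      exact fun hd => hp.one_lt.ne' (Nat.dvd_one.mp ((Nat.dvd_add_right hd).mp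
        ((Nat.sub_add_cancel hpos).symm ▸ hdvd.mul_right _)))
  · rw [carrier_eq_of_notMem hg, ncard_traceDet_eq, padicValNat.mul (by omega) (by omega), hk,
      padicValNat.prime_pow, ← hk, padicValNat.eq_zero_of_not_dvd, add_zero]
    rcases card_roots_of_notMem hg with h | h
    · rwa [h, add_zero]
    · rw [h, show Fintype.card k - 1 + 2 = Fintype.card k + 1 by omega, Nat.dvd_add_right hdvd]
      exact hp.one_lt.ne' ∘ Nat.dvd_one.mp

theorem padicValRat_finprod_ncard_carrier {p e : ℕ} (hp : p.Prime) (he : 0 < e)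
    (hk : Fintype.card k = p ^ e) :
    (∏ᶠ c : ConjClasses (GL (Fin 2) k), (c.carrier.ncard : ℚ)) ≠ 0 ∧
      padicValRat p (∏ᶠ c : ConjClasses (GL (Fin 2) k), (c.carrier.ncard : ℚ)) =
        e * (p ^ e - 1 : ℤ) ^ 2 := by
  classical
  have := Fact.mk hp
  have hq : 1 < Fintype.card k := Fintype.one_lt_card
  have := Fintype.ofFinite (ConjClasses (GL (Fin 2) k))
  have h := padicValNat_ncard_carrier hp he hk
  have hne : ∀ c ∈ (Finset.univ : Finset (ConjClasses (GL (Fin 2) k))),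
      (c.carrier.ncard : ℚ) ≠ 0 := fun c _ => Nat.cast_ne_zero.mpr (h c).1
  rw [finprod_eq_prod_of_fintype]
  refine ⟨Finset.prod_ne_zero_iff.mpr hne, ?_⟩
  have hcard := ncard_traceDet_notMem (k := k)
  rw [Set.ncard_eq_toFinset_card', Set.toFinset_ofPred] at hcard
  rw [padicValRat_finset_prod _ _ hne]
  simp only [padicValRat.of_nat, (h _).2]
  simp only [← ite_not (p := _ ∈ _)]
  rw [← Nat.cast_sum, ← Finset.sum_filter, Finset.sum_const, hcard, smul_eq_mul, hk]
  push_cast [Nat.cast_sub (hk ▸ hq.le : 1 ≤ p ^ e)]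
  ring

end GL2

/-- For `q = p ^ e`, the `p`-adic valuation of `h(GL_2(F_q))` is `e (q - 1)(q - 2)`. -/
theorem valuation_harada_GL2 (p e : ℕ) (hp : p.Prime) (he : 0 < e)
    (k : Type) [Field k] [Fintype k] (hk : Fintype.card k = p ^ e) :
    groupH (GL (Fin 2) k) ≠ 0 ∧
      padicValRat p (groupH (GL (Fin 2) k)) =
        (e : ℤ) * (((p : ℤ) ^ e - 1) * ((p : ℤ) ^ e - 2)) := by
  have := Fact.mk hp
  obtain ⟨h1, h2⟩ := GL2.padicValRat_finprod_ncard_carrier hp he hk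
  obtain ⟨h3, h4⟩ := GL2.padicValRat_finprod_degree hp he hk
  refine ⟨div_ne_zero h1 h3, ?_⟩
  rw [groupH, padicValRat.div h1 h3, h2, h4]
  ring
end
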